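/- Let 1 ≤ p < ∞ and let g be admissible with g > 0 on ℝ^n∖{0}. Then for every Lipschitz continuous u : ℝ^n → ℝ with compact support, the weighted Pólya–Szegő-type inequality ∫_{ℝ^n} |∇u(x)|^p g(x)^{1−p} dx ≥ ∫_{ℝ^n} |∇(R_g[u])(x)|^p g(x)^{1−p} dx holds, where the gradients exist almost everywhere (both u and the radial nonincreasing function R_g[u] are differentiable a.e.). -/

import Mathlib

open Real MeasureTheory Filter Topology Set

/-- The measure determined by `g`: `μ_g(A) = ∫_A g(x) dx`. -/
noncomputable def muG (n : ℕ) (g : EuclideanSpace ℝ (Fin n) → ℝ)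
    (A : Set (EuclideanSpace ℝ (Fin n))) : ENNReal :=
  ∫⁻ x in A, ENNReal.ofReal (g x)

/-- The distribution function of `u` with respect to `g`:
`μ_g[u](t) = μ_g({x : |u(x)| > t})`. -/
noncomputable def distG (n : ℕ) (g u : EuclideanSpace ℝ (Fin n) → ℝ) (t : ℝ) : ENNReal :=
  muG n g {x | t < |u x|}

/-- The rearrangement of `u` with respect to `g`:
`R_g[u](x) = sup {t ≥ 0 : μ_g[u](t) > μ_g(B_{|x|})}`. -/
noncomputable def rearrG (n : ℕ) (g u : EuclideanSpace ℝ (Fin n) → ℝ)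
    (x : EuclideanSpace ℝ (Fin n)) : ℝ :=
  sSup {t : ℝ | 0 ≤ t ∧ muG n g (Metric.ball 0 ‖x‖) < distG n g u t}

/-- `g` is admissible: locally integrable, radial, continuous away from the origin,
nonnegative, and nonincreasing in `|x|`. -/
def Admissible (n : ℕ) (g : EuclideanSpace ℝ (Fin n) → ℝ) : Prop :=
  MeasureTheory.LocallyIntegrable g MeasureTheory.volume ∧
  (∀ x y : EuclideanSpace ℝ (Fin n), ‖x‖ = ‖y‖ → g x = g y) ∧
  ContinuousOn g {x : EuclideanSpace ℝ (Fin n) | x ≠ 0} ∧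
  (∀ x : EuclideanSpace ℝ (Fin n), x ≠ 0 → 0 ≤ g x) ∧
  (∀ x y : EuclideanSpace ℝ (Fin n), x ≠ 0 → y ≠ 0 → ‖x‖ ≤ ‖y‖ → g y ≤ g x)

lemma bm1_compact {K L C : Set ℝ} (hK : IsCompact K) (hL : IsCompact L) (hK0 : K.Nonempty)
    (hL0 : L.Nonempty) (h : ∀ a ∈ K, ∀ b ∈ L, a + b ∈ C) :
    volume K + volume L ≤ volume C := by
  set s := sSup K
  set i := sInf L
  have hs : s ∈ K := hK.sSup_mem hK0
  have hi : i ∈ L := hL.sInf_mem hL0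
  set K' := (fun x => x + i) '' K
  set L' := (fun x => s + x) '' L
  have hK' : volume K' = volume K := by
    simp [K']
  have hL' : volume L' = volume L := by
    simp [L']
  have hL'm : MeasurableSet L' := (hL.image (by fun_prop)).measurableSet
  have hd : volume (K' ∩ L') = 0 := by
    apply measure_mono_null (t := {s + i})
    · rintro x ⟨⟨a, ha, rfl⟩, ⟨b, hb, hab⟩⟩
      have h1 : a ≤ s := le_csSup hK.bddAbove ha
      have h2 : i ≤ b := csInf_le hL.bddBelow hb
      simp only [mem_singleton_iff] at *
      linarith
    · simp
  rw [← hK', ← hL', ← measure_union₀ hL'm.nullMeasurableSet hd]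
  apply measure_mono
  rintro x (⟨a, ha, rfl⟩ | ⟨b, hb, rfl⟩)
  · exact h _ ha _ hi
  · exact h _ hs _ hb

lemma bm1_add {A B C : Set ℝ} (hA : MeasurableSet A) (hB : MeasurableSet B) (hA0 : A.Nonempty)
    (hB0 : B.Nonempty) (h : ∀ a ∈ A, ∀ b ∈ B, a + b ∈ C) :
    volume A + volume B ≤ volume C := by
  obtain ⟨a, ha⟩ := hA0
  obtain ⟨b, hb⟩ := hB0
  rw [hA.measure_eq_iSup_isCompact, hB.measure_eq_iSup_isCompact]
  simp_rw [iSup_and']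
  refine ENNReal.biSup_add_biSup_le' ⟨∅, by simp⟩ ⟨∅, by simp⟩ ?_
  rintro K ⟨hKA, hK⟩ L ⟨hLB, hL⟩
  calc volume K + volume L ≤ volume (insert a K) + volume (insert b L) := by
        gcongr <;> exact subset_insert _ _
    _ ≤ _ := bm1_compact (hK.insert a) (hL.insert b) (by simp) (by simp)
      (fun x hx y hy => h _ (insert_subset ha hKA hx) _ (insert_subset hb hLB hy))

lemma bm1 {A B C : Set ℝ} {l : ℝ} (hl : 0 < l) (hl1 : l < 1)
    (hA : MeasurableSet A) (hB : MeasurableSet B) (hA0 : A.Nonempty)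
    (hB0 : B.Nonempty) (h : ∀ a ∈ A, ∀ b ∈ B, (1 - l) * a + l * b ∈ C) :
    ENNReal.ofReal (1 - l) * volume A + ENNReal.ofReal l * volume B ≤ volume C := by
  have h1 : volume ((fun x => (1 - l) * x) '' A) = ENNReal.ofReal (1 - l) * volume A := by
    have := Measure.addHaar_smul (volume : Measure ℝ) (1 - l) A
    simpa [abs_of_pos (sub_pos.2 hl1), ← image_smul] using this
  have h2 : volume ((fun x => l * x) '' B) = ENNReal.ofReal l * volume B := by
    have := Measure.addHaar_smul (volume : Measure ℝ) l B
    simpa [abs_of_pos hl, ← image_smul] using this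
  rw [← h1, ← h2]
  apply bm1_add _ _ (hA0.image _) (hB0.image _)
  · rintro _ ⟨a, ha, rfl⟩ _ ⟨b, hb, rfl⟩
    exact h a ha b hb
  · exact hA.const_smul₀ (1 - l)
  · exact hB.const_smul₀ l

lemma ennreal_amgm {l : ℝ} (hl : 0 < l) (hl1 : l < 1) (x y : ENNReal) :
    x ^ (1 - l) * y ^ l ≤ ENNReal.ofReal (1 - l) * x + ENNReal.ofReal l * y := by
  have hl' : 0 < 1 - l := by linarith
  have hpq : (1 - l)⁻¹.HolderConjugate l⁻¹ := by
    rw [Real.holderConjugate_iff]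
    exact ⟨(one_lt_inv₀ hl').2 (by linarith), by simp⟩
  have := ENNReal.young_inequality (x ^ (1 - l)) (y ^ l) hpq
  rw [← ENNReal.rpow_mul, ← ENNReal.rpow_mul, mul_inv_cancel₀ hl'.ne', mul_inv_cancel₀ hl.ne',
    ENNReal.rpow_one, ENNReal.rpow_one, ENNReal.ofReal_inv_of_pos hl,
    ENNReal.ofReal_inv_of_pos hl', div_eq_mul_inv, div_eq_mul_inv, inv_inv, inv_inv] at this
  rwa [mul_comm _ x, mul_comm _ y]

lemma pl1_norm {l : ℝ} (hl : 0 < l) (hl1 : l < 1) {F G H : ℝ → ℝ}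
    (hF : Measurable F) (hG : Measurable G) (hH : Measurable H)
    (hF0 : ∀ s, 0 ≤ F s) (hG0 : ∀ s, 0 ≤ G s) (hH0 : ∀ s, 0 ≤ H s)
    (hF1 : ∀ s, F s ≤ 1) (hG1 : ∀ s, G s ≤ 1)
    (hFs : ∀ t < 1, ∃ s, t < F s) (hGs : ∀ t < 1, ∃ s, t < G s)
    (h : ∀ s t, F s ^ (1 - l) * G t ^ l ≤ H ((1 - l) * s + l * t)) :
    (∫⁻ s, ENNReal.ofReal (F s)) ^ (1 - l) * (∫⁻ s, ENNReal.ofReal (G s)) ^ l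
      ≤ ∫⁻ s, ENNReal.ofReal (H s) := by
  refine (ennreal_amgm hl hl1 _ _).trans ?_
  rw [lintegral_eq_lintegral_meas_lt volume (.of_forall hF0) hF.aemeasurable,
    lintegral_eq_lintegral_meas_lt volume (.of_forall hG0) hG.aemeasurable,
    lintegral_eq_lintegral_meas_lt volume (.of_forall hH0) hH.aemeasurable]
  have am : ∀ f : ℝ → ℝ, Antitone fun t => volume {a : ℝ | t < f a} := by
    intro f s t hst
    exact measure_mono (fun x (hx : t < f x) => lt_of_le_of_lt hst hx)
  rw [← lintegral_const_mul _ (am F).measurable, ← lintegral_const_mul _ (am G).measurable,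
    ← lintegral_add_left ((am F).measurable.const_mul _)]
  apply setLIntegral_mono (am H).measurable
  intro t ht
  have ht : 0 < t := ht
  rcases lt_or_ge t 1 with h1 | h1
  · apply bm1 hl hl1 (measurableSet_lt measurable_const hF) (measurableSet_lt measurable_const hG)
      (hFs t h1) (hGs t h1)
    intro a ha b hb
    refine lt_of_lt_of_le ?_ (h a b)
    have ha : t < F a := ha
    have hb : t < G b := hb
    calc t = t ^ (1 - l) * t ^ l := by rw [← rpow_add ht]; simp
      _ < F a ^ (1 - l) * G b ^ l := by
        apply mul_lt_mul'' (rpow_lt_rpow ht.le ha (by linarith)) (rpow_lt_rpow ht.le hb hl) <;>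
        positivity
  · have e1 : {a | t < F a} = ∅ := by
      ext x; simp; linarith [hF1 x]
    have e2 : {a | t < G a} = ∅ := by
      ext x; simp; linarith [hG1 x]
    simp [e1, e2]

lemma pl1 {l : ℝ} (hl : 0 < l) (hl1 : l < 1) {F G H : ℝ → ℝ} {M N : ℝ}
    (hF : Measurable F) (hG : Measurable G) (hH : Measurable H)
    (hF0 : ∀ s, 0 ≤ F s) (hG0 : ∀ s, 0 ≤ G s) (hH0 : ∀ s, 0 ≤ H s)
    (hF1 : ∀ s, F s ≤ M) (hG1 : ∀ s, G s ≤ N)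
    (h : ∀ s t, F s ^ (1 - l) * G t ^ l ≤ H ((1 - l) * s + l * t)) :
    (∫⁻ s, ENNReal.ofReal (F s)) ^ (1 - l) * (∫⁻ s, ENNReal.ofReal (G s)) ^ l
      ≤ ∫⁻ s, ENNReal.ofReal (H s) := by
  have hl' : 0 < 1 - l := by linarith
  by_cases hFz : ∀ s, F s = 0
  · simp [hFz, hl']
  by_cases hGz : ∀ s, G s = 0
  · simp [hGz, hl]
  push Not at hFz hGz
  have hbF : BddAbove (range F) := ⟨M, by rintro _ ⟨s, rfl⟩; exact hF1 s⟩
  have hbG : BddAbove (range G) := ⟨N, by rintro _ ⟨s, rfl⟩; exact hG1 s⟩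
  obtain ⟨s0, hs0⟩ := hFz
  obtain ⟨t0, ht0⟩ := hGz
  set a := ⨆ s, F s with ha_def
  set b := ⨆ s, G s with hb_def
  have ha : 0 < a := lt_of_lt_of_le (lt_of_le_of_ne (hF0 s0) hs0.symm) (le_ciSup hbF s0)
  have hb : 0 < b := lt_of_lt_of_le (lt_of_le_of_ne (hG0 t0) ht0.symm) (le_ciSup hbG t0)
  set c := a ^ (1 - l) * b ^ l with hc_def
  have hc : 0 < c := by positivity
  have key := pl1_norm hl hl1 (F := fun s => F s / a) (G := fun s => G s / b)
    (H := fun s => H s / c) (hF.div_const _) (hG.div_const _) (hH.div_const _)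
    (fun s => div_nonneg (hF0 s) ha.le) (fun s => div_nonneg (hG0 s) hb.le)
    (fun s => div_nonneg (hH0 s) hc.le)
    (fun s => (div_le_one ha).2 (le_ciSup hbF s)) (fun s => (div_le_one hb).2 (le_ciSup hbG s))
    (by
      intro t ht
      obtain ⟨s, hs⟩ := exists_lt_of_lt_ciSup (show t * a < ⨆ s, F s by
        rw [← ha_def]; nlinarith)
      exact ⟨s, by rwa [lt_div_iff₀ ha]⟩)
    (by
      intro t ht
      obtain ⟨s, hs⟩ := exists_lt_of_lt_ciSup (show t * b < ⨆ s, G s by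
        rw [← hb_def]; nlinarith)
      exact ⟨s, by rwa [lt_div_iff₀ hb]⟩)
    (by
      intro s t
      rw [div_rpow (hF0 s) ha.le, div_rpow (hG0 t) hb.le, div_mul_div_comm]
      exact div_le_div_of_nonneg_right (h s t) hc.le)
  have hsc : ∀ (f : ℝ → ℝ) (d : ℝ), 0 < d → Measurable f →
      ∫⁻ s, ENNReal.ofReal (f s) = ENNReal.ofReal d * ∫⁻ s, ENNReal.ofReal (f s / d) := by
    intro f d hd hf
    rw [← lintegral_const_mul _ (by fun_prop)]
    congr 1; ext s
    rw [← ENNReal.ofReal_mul hd.le]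
    congr 1; field_simp
  rw [hsc F a ha hF, hsc G b hb hG, hsc H c hc hH, ENNReal.mul_rpow_of_nonneg _ _ hl'.le,
    ENNReal.mul_rpow_of_nonneg _ _ hl.le, mul_mul_mul_comm, ENNReal.ofReal_rpow_of_pos ha,
    ENNReal.ofReal_rpow_of_pos hb, ← ENNReal.ofReal_mul (by positivity)]
  gcongr

section bmsec

open scoped Pointwise

lemma vol_cons {n : ℕ} {A : Set (Fin (n + 1) → ℝ)} (hA : MeasurableSet A) :
    volume A = ∫⁻ s : ℝ, volume {x : Fin n → ℝ | (Fin.cons s x : Fin (n + 1) → ℝ) ∈ A} ∧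
    Measurable fun s : ℝ => volume {x : Fin n → ℝ | (Fin.cons s x : Fin (n + 1) → ℝ) ∈ A} := by
  set e := MeasurableEquiv.piFinSuccAbove (fun _ : Fin (n + 1) => ℝ) 0
  have hmp := (volume_preserving_piFinSuccAbove (fun _ : Fin (n + 1) => ℝ) 0).symm
  have h1 : MeasurableSet (e.symm ⁻¹' A) := e.symm.measurable hA
  have h2 : ∀ s : ℝ, Prod.mk s ⁻¹' (e.symm ⁻¹' A) =
      {x : Fin n → ℝ | (Fin.cons s x : Fin (n + 1) → ℝ) ∈ A} := by
    intro s; ext x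
    simp [e, MeasurableEquiv.piFinSuccAbove, Fin.insertNthEquiv]
  constructor
  · rw [← hmp.measure_preimage hA.nullMeasurableSet]
    rw [Measure.volume_eq_prod, Measure.prod_apply h1]
    simp_rw [h2]
  · simp_rw [← h2]
    exact measurable_measure_prodMk_left h1

lemma sec_bdd {n : ℕ} {A : Set (Fin (n + 1) → ℝ)} (hA : Bornology.IsBounded A) :
    ∃ R : ℝ, ∀ s : ℝ, {x : Fin n → ℝ | (Fin.cons s x : Fin (n + 1) → ℝ) ∈ A} ⊆
      Metric.closedBall 0 R := by
  obtain ⟨R, hR⟩ := hA.subset_closedBall 0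
  refine ⟨max R 0, fun s x hx => ?_⟩
  have := hR hx
  rw [mem_closedBall_zero_iff] at this ⊢
  rw [pi_norm_le_iff_of_nonneg (le_max_right _ _)]
  intro i
  have h1 := (norm_le_pi_norm (Fin.cons s x : Fin (n + 1) → ℝ) i.succ).trans this
  simp only [Fin.cons_succ] at h1
  exact h1.trans (le_max_left _ _)

lemma bm_pi {l : ℝ} (hl : 0 < l) (hl1 : l < 1) (n : ℕ) : ∀ {A B C : Set (Fin n → ℝ)},
    MeasurableSet A → MeasurableSet B → MeasurableSet C →
    Bornology.IsBounded A → Bornology.IsBounded B → Bornology.IsBounded C →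
    (∀ a ∈ A, ∀ b ∈ B, (1 - l) • a + l • b ∈ C) →
    volume A ^ (1 - l) * volume B ^ l ≤ volume C := by
  have hl' : 0 < 1 - l := by linarith
  induction n with
  | zero =>
    intro A B C _ _ _ _ _ _ h
    rcases A.eq_empty_or_nonempty with rfl | ⟨a, ha⟩
    · simp [hl']
    rcases B.eq_empty_or_nonempty with rfl | ⟨b, hb⟩
    · simp [hl]
    have hC : C = univ := by
      ext x; simp only [mem_univ, iff_true]
      convert h a ha b hb
    have h1 : ∀ S : Set (Fin 0 → ℝ), volume S ≤ 1 := by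
      intro S
      refine (measure_mono (subset_univ S)).trans ?_
      simp [volume_pi]
    calc volume A ^ (1 - l) * volume B ^ l ≤ 1 ^ (1 - l) * 1 ^ l := by
          gcongr <;> exact h1 _
      _ = 1 := by simp
      _ ≤ volume C := by rw [hC]; simp [volume_pi]
  | succ n ih =>
    intro A B C hA hB hC bA bB bC h
    obtain ⟨eA, mA⟩ := vol_cons hA
    obtain ⟨eB, mB⟩ := vol_cons hB
    obtain ⟨eC, mC⟩ := vol_cons hC
    obtain ⟨RA, hRA⟩ := sec_bdd bA
    obtain ⟨RB, hRB⟩ := sec_bdd bB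
    obtain ⟨RC, hRC⟩ := sec_bdd bC
    have fin : ∀ R : ℝ, volume (Metric.closedBall (0 : Fin n → ℝ) R) ≠ ⊤ :=
      fun R => (isCompact_closedBall _ _).measure_lt_top.ne
    have tr : ∀ (S : Set (Fin (n + 1) → ℝ)) (R : ℝ),
        (∀ s : ℝ, {x : Fin n → ℝ | (Fin.cons s x : Fin (n + 1) → ℝ) ∈ S} ⊆
          Metric.closedBall 0 R) → ∀ s : ℝ,
        volume {x : Fin n → ℝ | (Fin.cons s x : Fin (n + 1) → ℝ) ∈ S} ≠ ⊤ := by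
      intro S R h s
      exact ne_top_of_le_ne_top (fin R) (measure_mono (h s))
    have key := pl1 hl hl1 (mA.ennreal_toReal) (mB.ennreal_toReal) (mC.ennreal_toReal)
      (fun s => ENNReal.toReal_nonneg) (fun s => ENNReal.toReal_nonneg)
      (fun s => ENNReal.toReal_nonneg)
      (fun s => ENNReal.toReal_mono (fin RA) (measure_mono (hRA s)))
      (fun s => ENNReal.toReal_mono (fin RB) (measure_mono (hRB s)))
      (by
        intro s t
        rw [ENNReal.toReal_rpow, ENNReal.toReal_rpow, ← ENNReal.toReal_mul]
        apply ENNReal.toReal_mono (tr C RC hRC _)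
        have mc : ∀ s : ℝ, Measurable (fun x : Fin n → ℝ => (Fin.cons s x : Fin (n + 1) → ℝ)) := by
          intro s
          refine measurable_pi_iff.2 (fun i => ?_)
          refine Fin.cases ?_ (fun j => ?_) i
          · simp
          · simpa using measurable_pi_apply j
        apply ih (mc s hA) (mc t hB) (mc _ hC)
          (Metric.isBounded_closedBall.subset (hRA s)) (Metric.isBounded_closedBall.subset (hRB t))
          (Metric.isBounded_closedBall.subset (hRC _))
        intro a ha b hb
        have := h _ ha _ hb
        change (Fin.cons _ _ : Fin (n + 1) → ℝ) ∈ C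
        convert this using 1
        ext i
        refine Fin.cases ?_ (fun j => ?_) i <;> simp)
    simp_rw [ENNReal.ofReal_toReal (tr A RA hRA _), ENNReal.ofReal_toReal (tr B RB hRB _),
      ENNReal.ofReal_toReal (tr C RC hRC _)] at key
    rwa [eA, eB, eC]

lemma bm_euc {l : ℝ} (hl : 0 < l) (hl1 : l < 1) {n : ℕ} {A B C : Set (EuclideanSpace ℝ (Fin n))}
    (hA : MeasurableSet A) (hB : MeasurableSet B) (hC : MeasurableSet C)
    (bA : Bornology.IsBounded A) (bB : Bornology.IsBounded B) (bC : Bornology.IsBounded C)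
    (h : ∀ a ∈ A, ∀ b ∈ B, (1 - l) • a + l • b ∈ C) :
    volume A ^ (1 - l) * volume B ^ l ≤ volume C := by
  have hmp := PiLp.volume_preserving_toLp (Fin n)
  have hb : ∀ S : Set (EuclideanSpace ℝ (Fin n)), Bornology.IsBounded S →
      Bornology.IsBounded ((WithLp.toLp 2 : (Fin n → ℝ) → _) ⁻¹' S) := by
    intro S hS
    have : ((WithLp.toLp 2 : (Fin n → ℝ) → EuclideanSpace ℝ (Fin n)) ⁻¹' S) =
        (EuclideanSpace.equiv (Fin n) ℝ) '' S := by
      ext x; simp only [mem_preimage, mem_image]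
      constructor
      · intro h; exact ⟨_, h, rfl⟩
      · rintro ⟨y, hy, rfl⟩; exact hy
    rw [this]
    exact (EuclideanSpace.equiv (Fin n) ℝ).lipschitz.isBounded_image hS
  rw [← hmp.measure_preimage hA.nullMeasurableSet, ← hmp.measure_preimage hB.nullMeasurableSet,
    ← hmp.measure_preimage hC.nullMeasurableSet]
  apply bm_pi hl hl1 n (hmp.measurable hA) (hmp.measurable hB) (hmp.measurable hC)
    (hb _ bA) (hb _ bB) (hb _ bC)
  intro a ha b hb
  exact h _ ha _ hb

/-- The isoperimetric-type estimate. -/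
lemma bm_ball {n : ℕ} (hn : n ≠ 0) {A C : Set (EuclideanSpace ℝ (Fin n))} {r ε : ℝ}
    (hr : 0 < r) (hε : 0 < ε)
    (hA : MeasurableSet A) (hC : MeasurableSet C)
    (bA : Bornology.IsBounded A) (bC : Bornology.IsBounded C)
    (hrA : volume (Metric.ball (0 : EuclideanSpace ℝ (Fin n)) r) ≤ volume A)
    (h : ∀ a ∈ A, ∀ b, ‖b‖ ≤ ε → a + b ∈ C) :
    volume A + ENNReal.ofReal ε * (n * volume (Metric.ball (0 : EuclideanSpace ℝ (Fin n)) 1) *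
      ENNReal.ofReal (r ^ (n - 1))) ≤ volume C := by
  have : Nonempty (Fin n) := ⟨⟨0, Nat.pos_of_ne_zero hn⟩⟩
  set ω := volume (Metric.ball (0 : EuclideanSpace ℝ (Fin n)) 1) with hω
  have hω0 : ω ≠ 0 := (Metric.measure_ball_pos _ _ one_pos).ne'
  have hωt : ω ≠ ⊤ := Metric.isBounded_ball.measure_lt_top.ne
  have hball : ∀ r : ℝ, 0 ≤ r → volume (Metric.ball (0 : EuclideanSpace ℝ (Fin n)) r) =
      ENNReal.ofReal (r ^ n) * ω := by
    intro r hr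
    rw [Measure.addHaar_ball _ _ hr]; simp [hω]
  -- choose `a` with `|A| = ω a^n`
  set α := (volume A / ω).toReal with hα
  have hAt : volume A ≠ ⊤ := bA.measure_lt_top.ne
  have hdt : volume A / ω ≠ ⊤ := (ENNReal.div_lt_top hAt hω0).ne
  set a := α ^ (1 / (n : ℝ)) with ha
  have hα0 : 0 ≤ α := ENNReal.toReal_nonneg
  have ha0 : 0 ≤ a := by positivity
  have han : a ^ n = α := by
    rw [ha, ← rpow_natCast, ← rpow_mul hα0]; field_simp; simp
  have hvA : volume A = ENNReal.ofReal (a ^ n) * ω := by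
    rw [han, hα, ENNReal.ofReal_toReal hdt, ENNReal.div_mul_cancel hω0 hωt]
  have hra : r ≤ a := by
    rw [hball r hr.le, hvA, ENNReal.mul_le_mul_iff_left hω0 hωt,
      ENNReal.ofReal_le_ofReal_iff (by positivity)] at hrA
    exact le_of_pow_le_pow_left₀ hn ha0 hrA
  have hapos : 0 < a := hr.trans_le hra
  set l := ε / (a + ε) with hldef
  have hl : 0 < l := by positivity
  have hl1 : l < 1 := by rw [hldef, div_lt_one (by positivity)]; linarith
  have hl' : 0 < 1 - l := by linarith
  have hsm : ∀ (c : ℝ) (S : Set (EuclideanSpace ℝ (Fin n))), 0 < c →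
      volume (c • S) = ENNReal.ofReal (c ^ n) * volume S := by
    intro c S hc
    rw [Measure.addHaar_smul]; simp [abs_of_pos hc]
  have key := bm_euc hl hl1 (A := a⁻¹ • A) (B := Metric.ball 0 1) (C := (a + ε)⁻¹ • C)
    (hA.const_smul₀ _) measurableSet_ball (hC.const_smul₀ _) (bA.smul₀ _) Metric.isBounded_ball
    (bC.smul₀ _) (by
      rintro _ ⟨x, hx, rfl⟩ b hb
      refine ⟨x + ε • b, h _ hx _ ?_, ?_⟩
      · rw [norm_smul, Real.norm_of_nonneg hε.le]
        have : ‖b‖ < 1 := by simpa using hb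
        nlinarith
      · simp only [smul_add, smul_smul]
        congr 2
        · rw [hldef]; field_simp; ring
        · rw [hldef]; field_simp)
  rw [hsm _ _ (by positivity), hsm _ _ (by positivity), hvA, ← mul_assoc,
    ← ENNReal.ofReal_mul (by positivity), ← mul_pow, inv_mul_cancel₀ hapos.ne', one_pow,
    ENNReal.ofReal_one, one_mul, ← ENNReal.rpow_add _ _ hω0 hωt, sub_add_cancel,
    ENNReal.rpow_one] at key
  have k2 : ENNReal.ofReal ((a + ε) ^ n) * ω ≤ volume C := by
    calc ENNReal.ofReal ((a + ε) ^ n) * ω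
        ≤ ENNReal.ofReal ((a + ε) ^ n) * (ENNReal.ofReal ((a + ε)⁻¹ ^ n) * volume C) := by gcongr
      _ = volume C := by
        rw [← mul_assoc, ← ENNReal.ofReal_mul (by positivity), ← mul_pow,
          mul_inv_cancel₀ (by positivity), one_pow, ENNReal.ofReal_one, one_mul]
  refine le_trans ?_ k2
  rw [hvA]
  have e1 : ENNReal.ofReal ε * (n * ω * ENNReal.ofReal (r ^ (n - 1))) =
      ENNReal.ofReal (ε * (n * r ^ (n - 1))) * ω := by
    rw [ENNReal.ofReal_mul hε.le, ENNReal.ofReal_mul (by positivity), ENNReal.ofReal_natCast]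
    ring
  rw [e1, ← add_mul, ← ENNReal.ofReal_add (by positivity) (by positivity)]
  gcongr
  have h1 : a ^ n + ε * (n * a ^ (n - 1)) ≤ (a + ε) ^ n := by
    obtain ⟨m, rfl⟩ := Nat.exists_eq_succ_of_ne_zero hn
    have := one_add_mul_le_pow (a := ε / a) (by have : 0 < ε / a := by positivity
                                                linarith) (m + 1)
    have h3 : (a + ε) ^ (m + 1) = a ^ (m + 1) * (1 + ε / a) ^ (m + 1) := by
      rw [← mul_pow]; congr 1; field_simp
    rw [Nat.succ_eq_add_one, h3]
    calc _ = a ^ (m + 1) * (1 + ((m + 1 : ℕ) : ℝ) * (ε / a)) := by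
          simp only [Nat.add_sub_cancel]; field_simp; ring
      _ ≤ _ := by gcongr
  have h2 : r ^ (n - 1) ≤ a ^ (n - 1) := by gcongr
  have h4 : ε * (n * r ^ (n - 1)) ≤ ε * (n * a ^ (n - 1)) := by gcongr
  linarith

end bmsec

lemma slab0 {n : ℕ} {f : EuclideanSpace ℝ (Fin n) → ℝ} {K : NNReal} (hf : LipschitzWith K f)
    (hf0 : ∀ x, 0 ≤ f x) (hc : HasCompactSupport f) {S : ℝ → ENNReal} (hS : Measurable S)
    (h : ∀ ε : ℝ, 0 < ε → ∀ τ : ℝ, 0 < τ → ∀ C : Set (EuclideanSpace ℝ (Fin n)),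
      MeasurableSet C → Bornology.IsBounded C → (∀ a, τ < f a → ∀ b, ‖b‖ ≤ ε → a + b ∈ C) →
      volume {x | τ < f x} + ENNReal.ofReal ε * S τ ≤ volume C) :
    ∫⁻ τ in Ioi 0, S τ ≤ ∫⁻ x, ENNReal.ofReal ‖fderiv ℝ f x‖ := by
  set fe : ℝ → EuclideanSpace ℝ (Fin n) → ℝ := fun ε x =>
    ⨆ z : Metric.closedBall (0 : EuclideanSpace ℝ (Fin n)) ε, f (x + z) with hfe
  have hlip : ∀ x y, f y ≤ f x + K * ‖y - x‖ := by
    intro x y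
    have := hf.dist_le_mul y x
    rw [Real.dist_eq, dist_eq_norm] at this
    linarith [le_abs_self (f y - f x)]
  have hub : ∀ ε x, ∀ z : Metric.closedBall (0 : EuclideanSpace ℝ (Fin n)) ε,
      f (x + z) ≤ f x + K * ε := by
    intro ε x z
    have h1 := hlip x (x + z)
    have h2 : ‖(z : EuclideanSpace ℝ (Fin n))‖ ≤ ε := mem_closedBall_zero_iff.1 z.2
    rw [add_sub_cancel_left] at h1
    have : (K : ℝ) * ‖(z : EuclideanSpace ℝ (Fin n))‖ ≤ K * ε := by gcongr
    linarith
  have hbdd : ∀ ε x, BddAbove (range fun z : Metric.closedBall (0 : EuclideanSpace ℝ (Fin n)) ε =>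
      f (x + z)) := by
    intro ε x
    exact ⟨_, by rintro _ ⟨z, rfl⟩; exact hub ε x z⟩
  have hne : ∀ ε : ℝ, 0 < ε → Nonempty (Metric.closedBall (0 : EuclideanSpace ℝ (Fin n)) ε) :=
    fun ε hε => ⟨⟨0, by simp [hε.le]⟩⟩
  have hge : ∀ ε x z, ‖z‖ ≤ ε → f (x + z) ≤ fe ε x := by
    intro ε x z hz
    exact le_ciSup (hbdd ε x) ⟨z, by simpa using hz⟩
  have hle : ∀ ε x c, 0 < ε → (∀ z, ‖z‖ ≤ ε → f (x + z) ≤ c) → fe ε x ≤ c := by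
    intro ε x c hε hz
    have := hne ε hε
    exact ciSup_le (fun z => hz z (mem_closedBall_zero_iff.1 z.2))
  have hself : ∀ ε x, 0 < ε → f x ≤ fe ε x := by
    intro ε x hε
    simpa using hge ε x 0 (by simpa using hε.le)
  have hmeas : ∀ ε, Measurable (fe ε) := by
    intro ε
    apply LowerSemicontinuous.measurable
    apply lowerSemicontinuous_ciSup (hbdd ε)
    intro z
    exact (hf.continuous.comp (by fun_prop : Continuous fun x => x + (z : EuclideanSpace ℝ (Fin n)))).lowerSemicontinuous
  have hK : IsCompact (tsupport f) := hc
  set T := Metric.cthickening 1 (tsupport f) with hT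
  have hTc : IsCompact T := hK.cthickening
  have hfeT : ∀ ε x, 0 < ε → ε ≤ 1 → x ∉ T → fe ε x = 0 := by
    intro ε x hε hε1 hx
    refine le_antisymm (hle ε x 0 hε ?_) ((hf0 x).trans (hself ε x hε))
    intro z hz
    by_contra hcon
    apply hx
    have : x + z ∈ tsupport f := subset_tsupport f (by
      simp only [Function.mem_support]; intro h0; rw [h0] at hcon; exact hcon le_rfl)
    apply Metric.mem_cthickening_of_dist_le x (x + z) 1 _ this
    simpa [dist_eq_norm] using hz.trans hε1
  have hfT : ∀ x, x ∉ T → f x = 0 := by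
    intro x hx
    by_contra h0
    exact hx (Metric.self_subset_cthickening _ (subset_tsupport f h0))
  set e : ℕ → ℝ := fun k => 1 / ((k : ℝ) + 1) with he
  have he0 : ∀ k, 0 < e k := fun k => by positivity
  have he1 : ∀ k, e k ≤ 1 := fun k => by
    simp only [he]
    rw [div_le_one (by positivity)]
    linarith [(Nat.cast_nonneg k : (0 : ℝ) ≤ k)]
  set q : ℕ → EuclideanSpace ℝ (Fin n) → ENNReal := fun k x =>
    ENNReal.ofReal ((fe (e k) x - f x) / e k) with hq
  have hfm : Measurable f := hf.continuous.measurable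
  have hqm : ∀ k, Measurable (q k) := fun k =>
    (((hmeas _).sub hfm).div_const _).ennreal_ofReal
  have hfint : ∫⁻ x, ENNReal.ofReal (f x) ≠ ⊤ :=
    (hf.continuous.integrable_of_hasCompactSupport hc).lintegral_lt_top.ne
  have am : ∀ f : EuclideanSpace ℝ (Fin n) → ℝ, Antitone fun t => volume {a | t < f a} := by
    intro f s t hst
    exact measure_mono (fun x (hx : t < f x) => lt_of_le_of_lt hst hx)
  have hk : ∀ k, ∫⁻ τ in Ioi 0, S τ ≤ ∫⁻ x, q k x := by
    intro k
    have e1 : ∫⁻ x, ENNReal.ofReal (fe (e k) x) =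
        (∫⁻ x, ENNReal.ofReal (f x)) + ENNReal.ofReal (e k) * ∫⁻ x, q k x := by
      rw [← lintegral_const_mul _ (hqm k), ← lintegral_add_left hfm.ennreal_ofReal]
      congr 1; ext x
      rw [← ENNReal.ofReal_mul (he0 k).le, ← ENNReal.ofReal_add (hf0 x)]
      · congr 1
        have := (he0 k).ne'
        field_simp
        ring
      · have := hself (e k) x (he0 k)
        have := he0 k
        apply mul_nonneg this.le (div_nonneg (by linarith) this.le)
    have e2 : (∫⁻ x, ENNReal.ofReal (f x)) + ENNReal.ofReal (e k) * ∫⁻ τ in Ioi 0, S τ ≤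
        ∫⁻ x, ENNReal.ofReal (fe (e k) x) := by
      rw [lintegral_eq_lintegral_meas_lt volume (.of_forall hf0) hfm.aemeasurable,
        lintegral_eq_lintegral_meas_lt volume
          (.of_forall fun x => (hf0 x).trans (hself (e k) x (he0 k))) (hmeas _).aemeasurable,
        ← lintegral_const_mul _ hS, ← lintegral_add_left (am f).measurable]
      apply setLIntegral_mono (am _).measurable
      intro τ hτ
      have hτ : 0 < τ := hτ
      apply h (e k) (he0 k) τ hτ _ (measurableSet_lt measurable_const (hmeas _))
      · apply hTc.isBounded.subset
        intro x hx
        by_contra hxT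
        have hx : τ < fe (e k) x := hx
        rw [hfeT _ x (he0 k) (he1 k) hxT] at hx
        linarith
      · intro a ha b hb
        change τ < fe (e k) (a + b)
        have := hge (e k) (a + b) (-b) (by simpa using hb)
        rw [add_neg_cancel_right] at this
        linarith
    rw [e1, ENNReal.add_le_add_iff_left hfint] at e2
    exact (ENNReal.mul_le_mul_iff_right (by simpa using he0 k) ENNReal.ofReal_ne_top).1 e2
  calc ∫⁻ τ in Ioi 0, S τ ≤ limsup (fun k => ∫⁻ x, q k x) atTop := by
        refine le_limsup_of_frequently_le (Eventually.of_forall hk).frequently (by isBoundedDefault)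
    _ ≤ ∫⁻ x, limsup (fun k => q k x) atTop := by
        apply limsup_lintegral_le (T.indicator fun _ => (K : ENNReal)) hqm
        · intro k
          refine Eventually.of_forall fun x => ?_
          by_cases hx : x ∈ T
          · simp only [hx, indicator_of_mem, hq]
            rw [← ENNReal.ofReal_coe_nnreal]
            apply ENNReal.ofReal_le_ofReal
            rw [div_le_iff₀ (he0 k)]
            have := hle (e k) x (f x + K * e k) (he0 k) (fun z hz => hub (e k) x ⟨z, by simpa using hz⟩)
            linarith
          · simp [hx, hq, hfeT _ x (he0 k) (he1 k) hx, hfT x hx]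
        · rw [lintegral_indicator_const hTc.isClosed.measurableSet]
          exact ENNReal.mul_ne_top (by simp) hTc.measure_lt_top.ne
    _ ≤ ∫⁻ x, ENNReal.ofReal ‖fderiv ℝ f x‖ := by
        apply lintegral_mono_ae
        filter_upwards [hf.ae_differentiableAt (μ := volume)] with x hx
        apply ENNReal.le_of_forall_pos_le_add
        intro δ hδ _
        have h1 := hx.hasFDerivAt.isLittleO.def (show (0 : ℝ) < δ by exact_mod_cast hδ)
        obtain ⟨η, hη, hball⟩ := Metric.eventually_nhds_iff.1 h1
        have h2 : Tendsto e atTop (𝓝 0) := tendsto_one_div_add_atTop_nhds_zero_nat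
        refine limsup_le_of_le (by isBoundedDefault) ?_
        filter_upwards [h2.eventually (gt_mem_nhds hη)] with k hkη
        rw [← ENNReal.ofReal_coe_nnreal, ← ENNReal.ofReal_add (norm_nonneg _) δ.coe_nonneg]
        apply ENNReal.ofReal_le_ofReal
        rw [div_le_iff₀ (he0 k)]
        have := hle (e k) x (f x + (‖fderiv ℝ f x‖ + δ) * e k) (he0 k) (by
          intro z hz
          have h3 := hball (y := x + z) (by simpa [dist_eq_norm] using hz.trans_lt hkη)
          rw [add_sub_cancel_left] at h3
          have h4 := (fderiv ℝ f x).le_opNorm z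
          have h5 := le_abs_self ((fderiv ℝ f x) z)
          have h6 := le_abs_self (f (x + z) - f x - (fderiv ℝ f x) z)
          rw [Real.norm_eq_abs] at h3 h4
          have h7 : (‖fderiv ℝ f x‖ + δ) * ‖z‖ ≤ (‖fderiv ℝ f x‖ + δ) * e k := by
            gcongr
          linarith)
        linarith

lemma fderiv_eq_zero_of_min {E : Type*} [NormedAddCommGroup E] [NormedSpace ℝ E] {f : E → ℝ} {x : E}
    (h : ∀ y, f x ≤ f y) : fderiv ℝ f x = 0 :=
  IsLocalMin.fderiv_eq_zero (Eventually.of_forall h)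

lemma slab {n : ℕ} (hn : n ≠ 0) {v : EuclideanSpace ℝ (Fin n) → ℝ} {K : NNReal}
    (hv : LipschitzWith K v) (hv0 : ∀ x, 0 ≤ v x) (hc : HasCompactSupport v) {ρ : ℝ → ℝ}
    (hρm : Measurable ρ)
    (hρ : ∀ τ, 0 ≤ τ → 0 < ρ τ →
      volume (Metric.ball (0 : EuclideanSpace ℝ (Fin n)) (ρ τ)) ≤ volume {x | τ < v x})
    {s t : ℝ} (hs : 0 ≤ s) (hst : s < t) :
    ∫⁻ τ in Ioo s t, (if 0 < ρ τ then
      n * volume (Metric.ball (0 : EuclideanSpace ℝ (Fin n)) 1) * ENNReal.ofReal (ρ τ ^ (n - 1))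
      else 0) ≤ ∫⁻ x in v ⁻¹' Ioo s t, ENNReal.ofReal ‖fderiv ℝ v x‖ := by
  set S : ℝ → ENNReal := fun τ => if 0 < ρ τ then
      n * volume (Metric.ball (0 : EuclideanSpace ℝ (Fin n)) 1) * ENNReal.ofReal (ρ τ ^ (n - 1))
      else 0 with hSdef
  have hSm : Measurable S := by
    apply Measurable.ite (measurableSet_lt measurable_const hρm) _ measurable_const
    exact ((hρm.pow_const _).ennreal_ofReal).const_mul _
  set f : EuclideanSpace ℝ (Fin n) → ℝ := fun x => min (max (v x - s) 0) (t - s) with hfdef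
  have hf : LipschitzWith K f := by
    have h1 : LipschitzWith K fun x => v x - s := by
      apply LipschitzWith.of_dist_le_mul
      intro x y
      have := hv.dist_le_mul x y
      simpa [Real.dist_eq] using this
    exact (h1.max_const 0).min_const _
  have hf0 : ∀ x, 0 ≤ f x := fun x => le_min (le_max_right _ _) (by linarith)
  have hft : ∀ x, f x ≤ t - s := fun x => min_le_right _ _
  have hfc : HasCompactSupport f := by
    apply hc.mono
    intro x hx
    simp only [Function.mem_support] at hx ⊢
    intro h0
    apply hx
    simp only [hfdef, h0]
    rw [max_eq_right (by linarith), min_eq_left (by linarith)]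
  have hset : ∀ τ, 0 < τ → τ < t - s → ∀ x, τ < f x ↔ s + τ < v x := by
    intro τ h0 h1 x
    simp only [hfdef, lt_min_iff, lt_max_iff]
    constructor
    · rintro ⟨h | h, _⟩ <;> linarith
    · intro h; exact ⟨Or.inl (by linarith), h1⟩
  have key := slab0 hf hf0 hfc (S := fun τ => (Ioo 0 (t - s)).indicator (fun τ => S (s + τ)) τ)
    ((hSm.comp (measurable_const_add s)).indicator measurableSet_Ioo) (by
      intro ε hε τ hτ C hC bC h
      by_cases hτt : τ ∈ Ioo 0 (t - s)
      · rw [indicator_of_mem hτt]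
        by_cases hp : 0 < ρ (s + τ)
        · simp only [hSdef, hp, if_true]
          have hAe : {x | τ < f x} = {x | s + τ < v x} := by
            ext x; exact hset τ hτ hτt.2 x
          refine bm_ball hn hp hε (measurableSet_lt measurable_const hf.continuous.measurable) hC
            ?_ bC ?_ h
          · apply bC.subset
            intro x hx
            simpa using h x hx 0 (by simpa using hε.le)
          · rw [hAe]; exact hρ _ (by linarith) hp
        · simp only [hSdef, hp, if_false, mul_zero, add_zero]
          apply measure_mono
          intro x hx
          simpa using h x hx 0 (by simpa using hε.le)
      · rw [indicator_of_notMem hτt, mul_zero, add_zero]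
        apply measure_mono
        intro x hx
        simpa using h x hx 0 (by simpa using hε.le))
  have e1 : ∫⁻ τ in Ioo s t, S τ =
      ∫⁻ τ in Ioi 0, (Ioo 0 (t - s)).indicator (fun τ => S (s + τ)) τ := by
    rw [setLIntegral_indicator measurableSet_Ioo,
      inter_eq_left.2 (show Ioo 0 (t - s) ⊆ Ioi 0 from fun x hx => hx.1)]
    have hmp := measurePreserving_add_left (volume : Measure ℝ) s
    have := hmp.setLIntegral_comp_preimage_emb (measurableEmbedding_addLeft s) S (Ioo s t)
    rw [← this]
    simp
  rw [e1]
  refine key.trans ?_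
  rw [← lintegral_indicator (hv.continuous.measurable measurableSet_Ioo)]
  apply lintegral_mono
  intro x
  by_cases hx : x ∈ v ⁻¹' Ioo s t
  · have : f =ᶠ[𝓝 x] fun y => v y - s := by
      filter_upwards [hv.continuous.continuousAt.preimage_mem_nhds (isOpen_Ioo.mem_nhds hx)] with y hy
      have hy : s < v y ∧ v y < t := hy
      simp only [hfdef]
      rw [max_eq_left (by linarith), min_eq_left (by linarith)]
    simp only
    rw [indicator_of_mem hx, this.fderiv_eq, fderiv_sub_const]
  · simp only
    rw [indicator_of_notMem hx]
    have hx' : v x ≤ s ∨ t ≤ v x := by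
      by_contra hcon; push Not at hcon; exact hx hcon
    have : fderiv ℝ f x = 0 := by
      rcases hx' with h1 | h1
      · have : f x = 0 := by
          simp only [hfdef]; rw [max_eq_right (by linarith), min_eq_left (by linarith)]
        exact fderiv_eq_zero_of_min (fun y => this ▸ hf0 y)
      · have : f x = t - s := by
          simp only [hfdef]; rw [max_eq_left (by linarith), min_eq_right (by linarith)]
        exact IsLocalMax.fderiv_eq_zero (Eventually.of_forall fun y => this ▸ hft y)
    simp [this]

/-- surface area of the sphere of radius `r` (zero for `r ≤ 0`). -/
noncomputable def surfA (n : ℕ) (r : ℝ) : ENNReal :=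
  if 0 < r then
    n * volume (Metric.ball (0 : EuclideanSpace ℝ (Fin n)) 1) * ENNReal.ofReal (r ^ (n - 1))
  else 0

lemma measurable_surfA (n : ℕ) : Measurable (surfA n) := by
  apply Measurable.ite measurableSet_Ioi _ measurable_const
  exact ((measurable_id.pow_const _).ennreal_ofReal).const_mul _

lemma claimB {n : ℕ} (hn : n ≠ 0) {v : EuclideanSpace ℝ (Fin n) → ℝ} {K : NNReal}
    (hv : LipschitzWith K v) (hv0 : ∀ x, 0 ≤ v x) (hc : HasCompactSupport v) {ρ : ℝ → ℝ}
    (hρm : Measurable ρ)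
    (hρ : ∀ τ, 0 ≤ τ → 0 < ρ τ →
      volume (Metric.ball (0 : EuclideanSpace ℝ (Fin n)) (ρ τ)) ≤ volume {x | τ < v x})
    {k : ℝ → ENNReal} (hk : Measurable k) :
    ∫⁻ τ in Ioi 0, k τ * surfA n (ρ τ) ≤
      ∫⁻ x in v ⁻¹' Ioi 0, k (v x) * ENNReal.ofReal ‖fderiv ℝ v x‖ := by
  have hSm : Measurable fun τ => surfA n (ρ τ) := (measurable_surfA n).comp hρm
  have hvm := hv.continuous.measurable
  set D : EuclideanSpace ℝ (Fin n) → ENNReal := fun x => ENNReal.ofReal ‖fderiv ℝ v x‖ with hD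
  have hDm : Measurable D := (measurable_fderiv ℝ v).norm.ennreal_ofReal
  set m1 := (volume : Measure ℝ).withDensity fun τ => surfA n (ρ τ)
  set m2 := ((volume : Measure (EuclideanSpace ℝ (Fin n))).withDensity D).map v
  have hfin : IsFiniteMeasure ((volume : Measure (EuclideanSpace ℝ (Fin n))).withDensity D) := by
    apply isFiniteMeasure_withDensity
    have hK : IsCompact (tsupport v) := hc
    have : ∫⁻ x, D x ≤ ∫⁻ x, (tsupport v).indicator (fun _ => (K : ENNReal)) x := by
      apply lintegral_mono
      intro x
      by_cases hx : x ∈ tsupport v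
      · rw [indicator_of_mem hx, ← ENNReal.ofReal_coe_nnreal]
        exact ENNReal.ofReal_le_ofReal (norm_fderiv_le_of_lipschitz ℝ hv)
      · rw [indicator_of_notMem hx]
        have : fderiv ℝ v x = 0 := by
          have := (notMem_tsupport_iff_eventuallyEq.1 hx).fderiv_eq (𝕜 := ℝ)
          rw [this]; exact fderiv_const_apply 0
        simp only [hD, this]
        rw [norm_zero]; simp
    refine (this.trans_lt ?_).ne
    rw [lintegral_indicator_const hK.isClosed.measurableSet]
    exact ENNReal.mul_lt_top (by simp) hK.measure_lt_top
  have hfin2 : IsFiniteMeasure m2 := by infer_instance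
  have hle : ∀ E ⊆ Ioi (0 : ℝ), m1 E ≤ m2 E := by
    intro E hE
    apply (IsUnifLocDoublingMeasure.vitaliFamily (volume : Measure ℝ) 1).measure_le_of_frequently_le m2
      (withDensity_absolutelyContinuous _ _)
    intro x hx
    have hx0 : 0 < x := hE hx
    apply (Real.tendsto_Icc_vitaliFamily_right x).frequently
    apply Eventually.frequently
    filter_upwards [self_mem_nhdsWithin] with y hy
    have hy : x < y := hy
    have h1 : m1 (Icc x y) = m1 (Ioo x y) := by
      have : NullSingletonClass m1 := by infer_instance
      exact (measure_congr (Ioo_ae_eq_Icc (μ := m1))).symm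
    rw [h1]
    refine le_trans ?_ (measure_mono Ioo_subset_Icc_self)
    rw [Measure.map_apply hvm measurableSet_Ioo, withDensity_apply _ measurableSet_Ioo,
      withDensity_apply _ (hvm measurableSet_Ioo)]
    exact slab hn hv hv0 hc hρm hρ hx0.le hy
  have hle2 : m1.restrict (Ioi 0) ≤ m2.restrict (Ioi 0) := by
    rw [Measure.le_iff]
    intro E hE
    rw [Measure.restrict_apply hE, Measure.restrict_apply hE]
    exact hle _ inter_subset_right
  calc ∫⁻ τ in Ioi 0, k τ * surfA n (ρ τ) = ∫⁻ τ in Ioi 0, k τ ∂m1 := by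
        rw [setLIntegral_withDensity_eq_setLIntegral_mul _ hSm hk measurableSet_Ioi]
        simp [mul_comm]
    _ ≤ ∫⁻ τ in Ioi 0, k τ ∂m2 := lintegral_mono' hle2 le_rfl
    _ = _ := by
        rw [setLIntegral_map measurableSet_Ioi hk hvm,
          setLIntegral_withDensity_eq_setLIntegral_mul _ hDm (g := fun x => k (v x)) (hk.comp hvm)
            (hvm measurableSet_Ioi)]
        simp [mul_comm, hD]

lemma lintegral_norm_polar {n : ℕ} (hn : n ≠ 0) {f : ℝ → ENNReal} (hf : Measurable f) :
    ∫⁻ x : EuclideanSpace ℝ (Fin n), f ‖x‖ = ∫⁻ r in Ioi 0, surfA n r * f r := by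
  have : Nonempty (Fin n) := ⟨⟨0, Nat.pos_of_ne_zero hn⟩⟩
  set μ := (volume : Measure (EuclideanSpace ℝ (Fin n)))
  have hd : Module.finrank ℝ (EuclideanSpace ℝ (Fin n)) = n := by simp
  have hmp := μ.measurePreserving_homeomorphUnitSphereProd
  calc ∫⁻ x, f ‖x‖ ∂μ = ∫⁻ x : ({(0)}ᶜ : Set (EuclideanSpace ℝ (Fin n))), f (‖x.1‖) ∂(μ.comap (↑)) := by
        rw [lintegral_subtype_comap (measurableSet_singleton _).compl (fun x => f ‖x‖),
          restrict_compl_singleton]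
    _ = ∫⁻ x, f x.2 ∂μ.toSphere.prod (.volumeIoiPow (Module.finrank ℝ (EuclideanSpace ℝ (Fin n)) - 1)) := by
        have := hmp.lintegral_comp_emb
          (Homeomorph.measurableEmbedding _) (f ∘ Subtype.val ∘ Prod.snd)
        rw [Function.comp_def] at this
        simpa using this
    _ = μ.toSphere univ * ∫⁻ x : Ioi (0 : ℝ), f x ∂.volumeIoiPow (Module.finrank ℝ (EuclideanSpace ℝ (Fin n)) - 1) := by
        rw [lintegral_prod_symm _ (by fun_prop)]
        simp only [lintegral_const]
        rw [lintegral_mul_const _ (by fun_prop), mul_comm]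
    _ = _ := by
        rw [Measure.volumeIoiPow, lintegral_withDensity_eq_lintegral_mul _ (by fun_prop) (by fun_prop),
          Measure.toSphere_apply_univ, hd]
        simp only [Pi.mul_apply]
        rw [lintegral_subtype_comap measurableSet_Ioi
          (fun a : ℝ => ENNReal.ofReal (a ^ (n - 1)) * f a), ← lintegral_const_mul _ (by fun_prop)]
        apply setLIntegral_congr_fun measurableSet_Ioi
        intro r hr
        have hr : 0 < r := hr
        simp only [surfA, hr, if_true, mul_assoc, μ]

section radial
variable {φ ρ : ℝ → ℝ}

lemma deriv_left_zero {r a : ℝ} (ha : a < r) (h : ∀ y, a < y → y < r → φ y = φ r) :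
    deriv φ r = 0 := by
  by_cases hd : DifferentiableAt ℝ φ r
  · have h1 := hd.hasDerivAt.hasDerivWithinAt (s := Iio r)
    have h2 : HasDerivWithinAt φ 0 (Iio r) r := by
      refine (hasDerivWithinAt_const r (Iio r) (φ r)).congr_of_eventuallyEq ?_ rfl
      filter_upwards [Ioo_mem_nhdsLT ha] with y hy using h y hy.1 hy.2
    exact (uniqueDiffWithinAt_Iio r).eq_deriv _ h1 h2
  · exact deriv_zero_of_not_differentiableAt hd

lemma deriv_right_zero {r b c : ℝ} (hb : r < b) (h : ∀ y, r < y → y < b → φ y = c) :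
    deriv φ r = 0 := by
  by_cases hd : DifferentiableAt ℝ φ r
  · have hc : φ r = c := by
      have h1 : Tendsto φ (𝓝[>] r) (𝓝 (φ r)) := hd.continuousAt.tendsto.mono_left nhdsWithin_le_nhds
      have h2 : Tendsto φ (𝓝[>] r) (𝓝 c) := by
        refine tendsto_const_nhds.congr' ?_
        filter_upwards [Ioo_mem_nhdsGT hb] with y hy using (h y hy.1 hy.2).symm
      exact tendsto_nhds_unique h1 h2
    have h1 := hd.hasDerivAt.hasDerivWithinAt (s := Ioi r)
    have h2 : HasDerivWithinAt φ 0 (Ioi r) r := by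
      refine (hasDerivWithinAt_const r (Ioi r) (φ r)).congr_of_eventuallyEq ?_ rfl
      filter_upwards [Ioo_mem_nhdsGT hb] with y hy using (h y hy.1 hy.2).trans hc.symm
    exact (uniqueDiffWithinAt_Ioi r).eq_deriv _ h1 h2
  · exact deriv_zero_of_not_differentiableAt hd

lemma radA1 (hφ : Antitone φ) (hφ0 : ∀ r, 0 ≤ φ r)
    (hiff : ∀ τ r, 0 ≤ τ → 0 ≤ r → (τ < φ r ↔ r < ρ τ))
    {r : ℝ} (hr : 0 < r) (hd : deriv φ r ≠ 0) : 0 < φ r ∧ ρ (φ r) = r := by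
  have hpos : 0 < φ r := by
    refine lt_of_le_of_ne (hφ0 r) (fun h0 => hd ?_)
    exact IsLocalMin.deriv_eq_zero (Eventually.of_forall fun y => h0 ▸ hφ0 y)
  refine ⟨hpos, le_antisymm ?_ ?_⟩
  · by_contra hcon
    push Not at hcon
    exact lt_irrefl _ ((hiff _ r (hφ0 r) hr.le).2 hcon)
  · by_contra hcon
    push Not at hcon
    apply hd
    apply deriv_left_zero (a := max (ρ (φ r)) 0) (max_lt hcon hr)
    intro y hy hyr
    refine le_antisymm ?_ (hφ hyr.le)
    by_contra hc2
    push Not at hc2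
    have := (hiff _ y (hφ0 r) ((le_max_right _ _).trans hy.le)).1 hc2
    exact lt_irrefl _ (this.trans ((le_max_left _ _).trans_lt hy))

lemma radA2 (hφ : Antitone φ) (hφ0 : ∀ r, 0 ≤ φ r)
    (hiff : ∀ τ r, 0 ≤ τ → 0 ≤ r → (τ < φ r ↔ r < ρ τ))
    {r : ℝ} (hr : 0 ≤ r) (hρ0 : 0 ≤ ρ (φ r)) (hd : deriv φ (ρ (φ r)) ≠ 0) :
    ρ (φ r) = r := by
  refine le_antisymm ?_ ?_
  · by_contra hcon
    push Not at hcon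
    exact lt_irrefl _ ((hiff _ r (hφ0 r) hr).2 hcon)
  · by_contra hcon
    push Not at hcon
    apply hd
    apply deriv_right_zero hcon (c := φ r)
    intro y hy hyr
    refine le_antisymm ?_ (hφ hyr.le)
    by_contra hc2
    push Not at hc2
    have := (hiff _ y (hφ0 r) (hρ0.trans hy.le)).1 hc2
    exact lt_irrefl _ (this.trans hy)

lemma claimA (hφ : Antitone φ) (hφ0 : ∀ r, 0 ≤ φ r)
    (hiff : ∀ τ r, 0 ≤ τ → 0 ≤ r → (τ < φ r ↔ r < ρ τ))
    {n : ℕ} (hn : n ≠ 0) {k : ℝ → ENNReal} (hk : Measurable k) :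
    ∫⁻ x : EuclideanSpace ℝ (Fin n), k (φ ‖x‖) * ENNReal.ofReal |deriv φ ‖x‖| ≤
      ∫⁻ τ in Ioi 0, k τ * surfA n (ρ τ) := by
  have hm : Measurable (fun r => k (φ r) * ENNReal.ofReal |deriv φ r|) :=
    (hk.comp hφ.measurable).mul (by
      have := measurable_deriv φ
      fun_prop)
  rw [lintegral_norm_polar hn hm]
  set s : Set ℝ := {r | 0 < r ∧ deriv φ r ≠ 0} with hs
  have hsm : MeasurableSet s := by
    apply MeasurableSet.inter measurableSet_Ioi
    exact (measurable_deriv φ) (measurableSet_singleton 0).compl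
  have hcv := lintegral_image_eq_lintegral_abs_deriv_mul hsm
    (f := φ) (f' := deriv φ) (fun r hr => (differentiableAt_of_deriv_ne_zero hr.2).hasDerivAt.hasDerivWithinAt)
    (by
      intro a ha b hb hab
      rw [← (radA1 hφ hφ0 hiff ha.1 ha.2).2, ← (radA1 hφ hφ0 hiff hb.1 hb.2).2, hab])
    (fun τ => k τ * surfA n (ρ τ))
  calc _ ≤ ∫⁻ r in s, ENNReal.ofReal |deriv φ r| * (k (φ r) * surfA n (ρ (φ r))) := by
        rw [← lintegral_indicator measurableSet_Ioi, ← lintegral_indicator hsm]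
        apply lintegral_mono
        intro r
        by_cases hr : r ∈ s
        · have h0 : r ∈ Ioi (0 : ℝ) := hr.1
          simp only [indicator_of_mem hr, indicator_of_mem h0]
          rw [(radA1 hφ hφ0 hiff hr.1 hr.2).2]
          exact le_of_eq (by ring)
        · simp only [indicator_of_notMem hr]
          by_cases h0 : r ∈ Ioi (0 : ℝ)
          · have : deriv φ r = 0 := by
              by_contra hc; exact hr ⟨h0, hc⟩
            simp [this]
          · simp [indicator_of_notMem h0]
    _ = ∫⁻ τ in φ '' s, k τ * surfA n (ρ τ) := hcv.symm
    _ ≤ _ := by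
        apply lintegral_mono_set
        rintro _ ⟨r, hr, rfl⟩
        exact (radA1 hφ hφ0 hiff hr.1 hr.2).1

end radial

lemma exists_ball {n : ℕ} (hn : n ≠ 0) {ν : Measure (EuclideanSpace ℝ (Fin n))}
    (hac : ν ≪ volume) (hfin : ∀ R, ν (Metric.closedBall 0 R) ≠ ⊤) {M : ENNReal} {R : ℝ}
    (hR : 0 ≤ R) (hM : M ≤ ν (Metric.ball 0 R)) :
    ∃ r, 0 ≤ r ∧ ν (Metric.ball 0 r) = M := by
  have : Nonempty (Fin n) := ⟨⟨0, Nat.pos_of_ne_zero hn⟩⟩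
  set S : Set ℝ := {r | 0 ≤ r ∧ M ≤ ν (Metric.ball 0 r)} with hS
  have hSne : S.Nonempty := ⟨R, hR, hM⟩
  have hSb : BddBelow S := ⟨0, fun r hr => hr.1⟩
  have h0 : 0 ≤ sInf S := le_csInf hSne fun r hr => hr.1
  set r := sInf S with hr
  have hlim : Tendsto (fun k : ℕ => (1 : ℝ) / (k + 1)) atTop (𝓝 0) :=
    tendsto_one_div_add_atTop_nhds_zero_nat
  have hanti : ∀ {a b : ℕ}, a ≤ b → (1 : ℝ) / (b + 1) ≤ 1 / (a + 1) := fun h =>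
    Nat.one_div_le_one_div h
  refine ⟨r, h0, le_antisymm ?_ ?_⟩
  · have hU : Metric.ball (0 : EuclideanSpace ℝ (Fin n)) r =
        ⋃ k : ℕ, Metric.ball 0 (r - 1 / (k + 1)) := by
      ext x
      simp only [mem_ball_zero_iff, mem_iUnion]
      constructor
      · intro hx
        obtain ⟨k, hk⟩ := exists_nat_one_div_lt (sub_pos.2 hx)
        exact ⟨k, by linarith⟩
      · rintro ⟨k, hk⟩
        have : (0 : ℝ) < 1 / (k + 1) := by positivity
        linarith
    rw [hU, Monotone.measure_iUnion]
    · apply iSup_le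
      intro k
      have hk : (0 : ℝ) < 1 / (k + 1) := by positivity
      by_cases hk0 : 0 ≤ r - 1 / (k + 1)
      · by_contra hc
        push Not at hc
        have : r ≤ r - 1 / (k + 1) := csInf_le hSb ⟨hk0, hc.le⟩
        linarith
      · rw [Metric.ball_eq_empty.2 (by linarith)]; simp
    · intro a b hab
      apply Metric.ball_subset_ball
      have := hanti hab
      linarith
  · have h1 : ν (Metric.closedBall 0 r) = ν (Metric.ball 0 r) := by
      apply le_antisymm _ (measure_mono Metric.ball_subset_closedBall)
      rw [← Metric.ball_union_sphere]
      refine (measure_union_le _ _).trans ?_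
      rw [hac (Measure.addHaar_sphere _ _ _), add_zero]
    have hI : Metric.closedBall (0 : EuclideanSpace ℝ (Fin n)) r =
        ⋂ k : ℕ, Metric.closedBall 0 (r + 1 / (k + 1)) := by
      ext x
      simp only [mem_closedBall_zero_iff, mem_iInter]
      constructor
      · intro hx k
        have : (0 : ℝ) < 1 / (k + 1) := by positivity
        linarith
      · intro h
        by_contra hx
        push Not at hx
        obtain ⟨k, hk⟩ := exists_nat_one_div_lt (sub_pos.2 hx)
        have := h k
        linarith
    rw [← h1, hI, Antitone.measure_iInter]
    · apply le_iInf
      intro k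
      have hk : (0 : ℝ) < 1 / (k + 1) := by positivity
      obtain ⟨s, hs, hsr⟩ := exists_lt_of_csInf_lt hSne (show sInf S < r + 1 / (k + 1) by linarith)
      exact hs.2.trans (measure_mono ((Metric.ball_subset_ball hsr.le).trans
        Metric.ball_subset_closedBall))
    · intro a b hab
      apply Metric.closedBall_subset_closedBall
      have := hanti hab
      linarith
    · exact fun k => Metric.isClosed_closedBall.measurableSet.nullMeasurableSet
    · exact ⟨0, hfin _⟩

lemma ball_strict {n : ℕ} (hn : n ≠ 0) {ν : Measure (EuclideanSpace ℝ (Fin n))}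
    (hca : volume ≪ ν) (hfin : ∀ R, ν (Metric.closedBall 0 R) ≠ ⊤) {r s : ℝ} (hr : 0 ≤ r)
    (hrs : r < s) : ν (Metric.ball 0 r) < ν (Metric.ball 0 s) := by
  have : Nonempty (Fin n) := ⟨⟨0, Nat.pos_of_ne_zero hn⟩⟩
  have hf : ν (Metric.ball 0 r) ≠ ⊤ :=
    ne_top_of_le_ne_top (hfin r) (measure_mono Metric.ball_subset_closedBall)
  by_contra hcon
  push Not at hcon
  have h1 : ν (Metric.ball 0 s \ Metric.closedBall 0 r) = 0 := by
    refine measure_mono_null (sdiff_subset_sdiff_right Metric.ball_subset_closedBall) ?_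
    rw [measure_sdiff (Metric.ball_subset_ball hrs.le) Metric.isOpen_ball.nullMeasurableSet hf]
    exact tsub_eq_zero_of_le hcon
  have h2 := hca h1
  have hopen : IsOpen (Metric.ball (0 : EuclideanSpace ℝ (Fin n)) s \ Metric.closedBall 0 r) :=
    Metric.isOpen_ball.sdiff Metric.isClosed_closedBall
  obtain ⟨x, hx⟩ := _root_.exists_norm_eq (EuclideanSpace ℝ (Fin n)) 
    (show 0 ≤ (r + s) / 2 by linarith)
  have hne : (Metric.ball (0 : EuclideanSpace ℝ (Fin n)) s \ Metric.closedBall 0 r).Nonempty := by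
    refine ⟨x, ?_, ?_⟩
    · rw [mem_ball_zero_iff, hx]; linarith
    · rw [mem_closedBall_zero_iff, hx]; linarith
  exact (hopen.measure_pos volume hne).ne' h2

lemma setup_rho {n : ℕ} (hn : n ≠ 0) {ν : Measure (EuclideanSpace ℝ (Fin n))}
    (hac : ν ≪ volume) (hca : volume ≪ ν) (hfin : ∀ R, ν (Metric.closedBall 0 R) ≠ ⊤)
    {v : EuclideanSpace ℝ (Fin n) → ℝ} {R : ℝ} (hR : 0 ≤ R)
    (hvR : ∀ x, 0 < v x → x ∈ Metric.ball 0 R) {C : ℝ} (hC : ∀ x, v x ≤ C) {φ : ℝ → ℝ}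
    (hφ : ∀ r, φ r = sSup {t : ℝ | 0 ≤ t ∧ ν (Metric.ball 0 r) < ν {x | t < v x}}) :
    ∃ ρ : ℝ → ℝ, Antitone ρ ∧ (∀ τ, 0 ≤ ρ τ) ∧
      (∀ τ, 0 ≤ τ → ν (Metric.ball 0 (ρ τ)) = ν {x | τ < v x}) ∧ Antitone φ ∧
      (∀ r, 0 ≤ φ r) ∧ (∀ τ r, 0 ≤ τ → 0 ≤ r → (τ < φ r ↔ r < ρ τ)) := by
  have hex : ∀ τ : ℝ, ∃ r, 0 ≤ r ∧ ν (Metric.ball 0 r) = ν {x | max τ 0 < v x} := fun τ =>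
    exists_ball hn hac hfin hR
      (measure_mono fun x hx => hvR x ((le_max_right _ _).trans_lt hx))
  choose ρ hρ0 hρ using hex
  have hst : ∀ r s, 0 ≤ r → 0 ≤ s → (ν (Metric.ball 0 r) < ν (Metric.ball 0 s) ↔ r < s) := by
    intro r s hr hs
    refine ⟨fun h => ?_, fun h => ball_strict hn hca hfin hr h⟩
    by_contra hc
    push Not at hc
    exact absurd (measure_mono (Metric.ball_subset_ball hc)) (not_le.2 h)
  have hmono : ∀ {s t : ℝ}, s ≤ t → ν {x | t < v x} ≤ ν {x | s < v x} := fun h =>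
    measure_mono fun x hx => lt_of_le_of_lt h hx
  have hbdd : ∀ r, BddAbove {t : ℝ | 0 ≤ t ∧ ν (Metric.ball 0 r) < ν {x | t < v x}} := by
    intro r
    refine ⟨C, fun t ht => ?_⟩
    by_contra hc
    push Not at hc
    have : {x | t < v x} = ∅ := by
      ext x; simpa using (hC x).trans hc.le
    simp [this] at ht
  have hφ0 : ∀ r, 0 ≤ φ r := fun r => by
    rw [hφ]; exact Real.sSup_nonneg fun t ht => ht.1
  have hρe : ∀ τ, 0 ≤ τ → ν (Metric.ball 0 (ρ τ)) = ν {x | τ < v x} := by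
    intro τ hτ
    rw [hρ, max_eq_left hτ]
  refine ⟨ρ, ?_, hρ0, hρe, ?_, hφ0, ?_⟩
  · intro s t hst'
    by_contra hc
    push Not at hc
    have := (hst _ _ (hρ0 _) (hρ0 _)).2 hc
    rw [hρ, hρ] at this
    exact absurd (hmono (max_le_max_right 0 hst')) (not_le.2 this)
  · intro r s hrs
    by_cases hne : {t : ℝ | 0 ≤ t ∧ ν (Metric.ball 0 s) < ν {x | t < v x}}.Nonempty
    · rw [hφ, hφ]
      refine csSup_le_csSup (hbdd _) hne fun t ht => ⟨ht.1, lt_of_le_of_lt ?_ ht.2⟩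
      exact measure_mono (Metric.ball_subset_ball hrs)
    · rw [hφ s, not_nonempty_iff_eq_empty.1 hne, Real.sSup_empty]
      exact hφ0 r
  · intro τ r hτ hr
    rw [← hst _ _ hr (hρ0 τ), hρe τ hτ, hφ]
    constructor
    · intro h
      have hne : {t : ℝ | 0 ≤ t ∧ ν (Metric.ball 0 r) < ν {x | t < v x}}.Nonempty := by
        by_contra hc
        rw [not_nonempty_iff_eq_empty.1 hc, Real.sSup_empty] at h
        exact absurd hτ (not_le.2 h)
      obtain ⟨t, ht, hτt⟩ := exists_lt_of_lt_csSup hne h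
      exact ht.2.trans_le (hmono hτt.le)
    · intro h
      have hU : {x | τ < v x} = ⋃ k : ℕ, {x | τ + 1 / (k + 1) < v x} := by
        ext x
        simp only [mem_ofPred_eq, mem_iUnion]
        constructor
        · intro hx
          obtain ⟨k, hk⟩ := exists_nat_one_div_lt (sub_pos.2 hx)
          exact ⟨k, by linarith⟩
        · rintro ⟨k, hk⟩
          have : (0 : ℝ) < 1 / (k + 1) := by positivity
          linarith
      rw [hU, Monotone.measure_iUnion, lt_iSup_iff] at h
      · obtain ⟨k, hk⟩ := h
        have hk0 : (0 : ℝ) < 1 / (k + 1) := by positivity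
        exact (lt_add_of_pos_right τ hk0).trans_le (le_csSup (hbdd r) ⟨by positivity, hk⟩)
      · intro a b hab x hx
        have : (1 : ℝ) / (b + 1) ≤ 1 / (a + 1) := Nat.one_div_le_one_div hab
        have hx : τ + 1 / (a + 1) < v x := hx
        show τ + 1 / (b + 1) < v x
        linarith

/-- Passing from the weighted to the Lebesgue measure. -/
lemma vol_ball_le {n : ℕ} (hn : n ≠ 0) {g : EuclideanSpace ℝ (Fin n) → ℝ}
    (hgm : Measurable g) (hgpos : ∀ x, x ≠ 0 → 0 < g x)
    (hmono : ∀ x y : EuclideanSpace ℝ (Fin n), x ≠ 0 → y ≠ 0 → ‖x‖ ≤ ‖y‖ → g y ≤ g x)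
    {r : ℝ} (hr : 0 < r) {A : Set (EuclideanSpace ℝ (Fin n))} (hA : MeasurableSet A)
    (hfin : (volume.withDensity fun x => ENNReal.ofReal (g x)) (Metric.ball 0 r) ≠ ⊤)
    (h : (volume.withDensity fun x => ENNReal.ofReal (g x)) (Metric.ball 0 r) =
      (volume.withDensity fun x => ENNReal.ofReal (g x)) A) :
    volume (Metric.ball (0 : EuclideanSpace ℝ (Fin n)) r) ≤ volume A := by
  have : Nonempty (Fin n) := ⟨⟨0, Nat.pos_of_ne_zero hn⟩⟩
  set ν := volume.withDensity fun x => ENNReal.ofReal (g x) with hν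
  set B := Metric.ball (0 : EuclideanSpace ℝ (Fin n)) r with hB
  have hBm : MeasurableSet B := Metric.isOpen_ball.measurableSet
  obtain ⟨e, he⟩ := _root_.exists_norm_eq (EuclideanSpace ℝ (Fin n)) hr.le
  have he0 : e ≠ 0 := by
    intro h0; rw [h0, norm_zero] at he; exact hr.ne he
  set c := ENNReal.ofReal (g e)
  have hc0 : c ≠ 0 := by simpa [c] using hgpos e he0
  have hct : c ≠ ⊤ := ENNReal.ofReal_ne_top
  have hae : ∀ᵐ x : EuclideanSpace ℝ (Fin n), x ≠ 0 := by
    simp [ae_iff]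
  have h1 : c * volume (B \ A) ≤ ν (B \ A) := by
    rw [hν, withDensity_apply _ (hBm.diff hA), ← setLIntegral_const]
    refine setLIntegral_mono_ae hgm.ennreal_ofReal.aemeasurable ?_
    filter_upwards [hae] with x hx hxB
    apply ENNReal.ofReal_le_ofReal
    apply hmono x e hx he0
    rw [he]; exact (mem_ball_zero_iff.1 hxB.1).le
  have h2 : ν (A \ B) ≤ c * volume (A \ B) := by
    rw [hν, withDensity_apply _ (hA.diff hBm), ← setLIntegral_const]
    refine setLIntegral_mono_ae measurable_const.aemeasurable ?_
    filter_upwards [hae] with x hx hxB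
    apply ENNReal.ofReal_le_ofReal
    apply hmono e x he0 hx
    rw [he]
    have := hxB.2
    rw [hB, mem_ball_zero_iff] at this
    linarith
  have h3 : ν (B \ A) = ν (A \ B) := by
    have e1 := measure_inter_add_sdiff (μ := ν) B hA
    have e2 := measure_inter_add_sdiff (μ := ν) A hBm
    rw [inter_comm, ] at e2
    rw [← h, ← e1] at e2
    refine ((ENNReal.add_right_inj ?_).1 e2).symm
    exact ne_top_of_le_ne_top hfin (measure_mono inter_subset_left)
  have h4 : volume (B \ A) ≤ volume (A \ B) :=
    (ENNReal.mul_le_mul_iff_right hc0 hct).1 (h1.trans (h3.le.trans h2))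
  rw [← measure_inter_add_sdiff (μ := volume) B hA, ← measure_inter_add_sdiff (μ := volume) A hBm,
    inter_comm A B]
  gcongr

lemma norm_fderiv_abs_le {n : ℕ} {u : EuclideanSpace ℝ (Fin n) → ℝ} (hu : Continuous u)
    (x : EuclideanSpace ℝ (Fin n)) :
    ‖fderiv ℝ (fun y => |u y|) x‖ ≤ ‖fderiv ℝ u x‖ := by
  rcases lt_trichotomy (u x) 0 with h | h | h
  · have : (fun y => |u y|) =ᶠ[𝓝 x] fun y => - u y := by
      filter_upwards [hu.continuousAt.eventually (gt_mem_nhds h)] with y hy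
      exact abs_of_neg hy
    rw [this.fderiv_eq, fderiv_fun_neg, norm_neg]
  · have : fderiv ℝ (fun y => |u y|) x = 0 :=
      IsLocalMin.fderiv_eq_zero (Eventually.of_forall fun y => by simp [h])
    rw [this, norm_zero]; exact norm_nonneg _
  · have : (fun y => |u y|) =ᶠ[𝓝 x] u := by
      filter_upwards [hu.continuousAt.eventually (lt_mem_nhds h)] with y hy
      exact abs_of_pos hy
    rw [this.fderiv_eq]

lemma norm_fderiv_radial_le {n : ℕ} (φ : ℝ → ℝ) {x : EuclideanSpace ℝ (Fin n)} (hx : x ≠ 0) :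
    ‖fderiv ℝ (fun y : EuclideanSpace ℝ (Fin n) => φ ‖y‖) x‖ ≤ |deriv φ ‖x‖| := by
  by_cases hd : DifferentiableAt ℝ (fun y : EuclideanSpace ℝ (Fin n) => φ ‖y‖) x
  · have hx' : 0 < ‖x‖ := norm_pos_iff.2 hx
    set e := ‖x‖⁻¹ • x with he
    have hxe : ‖x‖ • e = x := by
      rw [he, smul_smul, mul_inv_cancel₀ hx'.ne', one_smul]
    have hne : ‖e‖ = 1 := by
      rw [he, norm_smul, norm_inv, norm_norm, inv_mul_cancel₀ hx'.ne']
    have hφ : DifferentiableAt ℝ φ ‖x‖ := by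
      have h1 : DifferentiableAt ℝ (fun r : ℝ => r • e) ‖x‖ := by fun_prop
      have h2 : DifferentiableAt ℝ (fun r : ℝ => φ ‖r • e‖) ‖x‖ := by
        have hd' : DifferentiableAt ℝ (fun y : EuclideanSpace ℝ (Fin n) => φ ‖y‖)
          ((fun r : ℝ => r • e) ‖x‖) := by simpa only [hxe] using hd
        exact DifferentiableAt.comp (g := fun y : EuclideanSpace ℝ (Fin n) => φ ‖y‖) ‖x‖ hd' h1
      refine h2.congr_of_eventuallyEq ?_
      filter_upwards [lt_mem_nhds hx'] with r hr
      rw [norm_smul, hne, mul_one, Real.norm_of_nonneg hr.le]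
    have hN : DifferentiableAt ℝ (fun y : EuclideanSpace ℝ (Fin n) => ‖y‖) x :=
      differentiableAt_id.norm ℝ hx
    have h3 := (hφ.hasDerivAt.comp_hasFDerivAt x hN.hasFDerivAt).fderiv
    have h4 : ‖fderiv ℝ (fun y : EuclideanSpace ℝ (Fin n) => ‖y‖) x‖ ≤ 1 := by
      simpa using norm_fderiv_le_of_lipschitz ℝ (x₀ := x) (lipschitzWith_one_norm (E := EuclideanSpace ℝ (Fin n)))
    have h5 : fderiv ℝ (fun y : EuclideanSpace ℝ (Fin n) => φ ‖y‖) x =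
      deriv φ ‖x‖ • fderiv ℝ (fun y : EuclideanSpace ℝ (Fin n) => ‖y‖) x := h3
    rw [h5, norm_smul, Real.norm_eq_abs]
    exact mul_le_of_le_one_right (abs_nonneg _) h4
  · rw [fderiv_zero_of_not_differentiableAt hd, norm_zero]
    exact abs_nonneg _

lemma young_aux {p M h : ℝ} (hp : 1 ≤ p) (hM : 0 ≤ M) (hh : 0 ≤ h) :
    p * (M ^ (p - 1) * h) ≤ h ^ p + (p - 1) * M ^ p := by
  rcases hp.eq_or_lt with rfl | hp1
  · simp
  · have hq : p.HolderConjugate (p / (p - 1)) := Real.HolderConjugate.conjExponent hp1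
    have h1 := Real.young_inequality_of_nonneg hh (Real.rpow_nonneg hM (p - 1)) hq
    rw [← Real.rpow_mul hM, mul_div_cancel₀ _ (by linarith : p - 1 ≠ 0)] at h1
    have hp0 : 0 < p := by linarith
    have h2 := mul_le_mul_of_nonneg_left h1 hp0.le
    have h3 : p * (h ^ p / p + M ^ p / (p / (p - 1))) = h ^ p + (p - 1) * M ^ p := by
      field_simp
    rw [h3] at h2
    linarith

lemma young_weight {p M d g : ℝ} (hp : 1 ≤ p) (hM : 0 ≤ M) (hd : 0 ≤ d) (hg : 0 < g) :
    p * (M ^ (p - 1) * d) ≤ d ^ p * g ^ (1 - p) + (p - 1) * (M ^ p * g) := by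
  have h1 := mul_le_mul_of_nonneg_right (young_aux hp hM (div_nonneg hd hg.le)) hg.le
  have h2 : (d / g) ^ p * g = d ^ p * g ^ (1 - p) := by
    rw [Real.div_rpow hd hg.le, Real.rpow_sub hg, Real.rpow_one]
    field_simp
  have h3 : p * (M ^ (p - 1) * (d / g)) * g = p * (M ^ (p - 1) * d) := by
    field_simp
  rw [h3, add_mul, h2] at h1
  linarith

lemma claimC {n : ℕ} {ν : Measure (EuclideanSpace ℝ (Fin n))}
    (hfin : ∀ R, ν (Metric.closedBall 0 R) ≠ ⊤)
    {v : EuclideanSpace ℝ (Fin n) → ℝ} (hv : Measurable v) {φ ρ : ℝ → ℝ}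
    (hφ : Antitone φ) (hρ : ∀ τ, 0 ≤ τ → ν (Metric.ball 0 (ρ τ)) = ν {x | τ < v x})
    (hiff : ∀ τ r, 0 ≤ τ → 0 ≤ r → (τ < φ r ↔ r < ρ τ)) :
    (ν.map v).restrict (Ioi 0) = (ν.map fun x => φ ‖x‖).restrict (Ioi 0) := by
  have hφm : Measurable fun x : EuclideanSpace ℝ (Fin n) => φ ‖x‖ :=
    hφ.measurable.comp measurable_norm
  have key : ∀ a : ℝ, 0 ≤ a → (ν.map v) (Ioi a) = (ν.map fun x => φ ‖x‖) (Ioi a) := by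
    intro a ha
    rw [Measure.map_apply hv measurableSet_Ioi, Measure.map_apply hφm measurableSet_Ioi]
    have h1 : v ⁻¹' Ioi a = {x | a < v x} := rfl
    rw [h1, ← hρ a ha]
    congr 1
    ext x
    simp only [mem_ball_zero_iff, mem_preimage, mem_Ioi]
    exact (hiff a ‖x‖ ha (norm_nonneg x)).symm
  have hf : IsFiniteMeasure ((ν.map v).restrict (Ioi 0)) := by
    refine ⟨?_⟩
    rw [Measure.restrict_apply_univ, Measure.map_apply hv measurableSet_Ioi]
    have h1 : v ⁻¹' Ioi 0 = {x | 0 < v x} := rfl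
    rw [h1, ← hρ 0 le_rfl]
    exact (measure_mono Metric.ball_subset_closedBall).trans_lt (hfin _).lt_top
  refine ext_of_generate_finite (range Ioi) (by rw [← borel_eq_generateFrom_Ioi]; exact BorelSpace.measurable_eq) isPiSystem_Ioi ?_ ?_
  · rintro _ ⟨a, rfl⟩
    rw [Measure.restrict_apply measurableSet_Ioi, Measure.restrict_apply measurableSet_Ioi,
      Ioi_inter_Ioi]
    exact key _ (le_max_right _ _)
  · rw [Measure.restrict_apply_univ, Measure.restrict_apply_univ]
    exact key 0 le_rfl

lemma assemble_trunc {n : ℕ} (hn : n ≠ 0) {p : ℝ} (hp : 1 ≤ p)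
    {g : EuclideanSpace ℝ (Fin n) → ℝ}
    (hgm : Measurable g) (hgpos : ∀ x, x ≠ 0 → 0 < g x)
    {ν : Measure (EuclideanSpace ℝ (Fin n))}
    (hν : ν = volume.withDensity fun x => ENNReal.ofReal (g x))
    (hfin : ∀ R, ν (Metric.closedBall 0 R) ≠ ⊤)
    {v : EuclideanSpace ℝ (Fin n) → ℝ} {K : NNReal} (hv : LipschitzWith K v)
    (hv0 : ∀ x, 0 ≤ v x) (hc : HasCompactSupport v) {φ ρ : ℝ → ℝ}
    (hφ : Antitone φ) (hφ0 : ∀ r, 0 ≤ φ r)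
    (hiff : ∀ τ r, 0 ≤ τ → 0 ≤ r → (τ < φ r ↔ r < ρ τ))
    (hρa : Antitone ρ) (hρ0 : ∀ τ, 0 ≤ ρ τ)
    (hρν : ∀ τ, 0 ≤ τ → ν (Metric.ball 0 (ρ τ)) = ν {x | τ < v x})
    (hρvol : ∀ τ, 0 ≤ τ → 0 < ρ τ →
      volume (Metric.ball (0 : EuclideanSpace ℝ (Fin n)) (ρ τ)) ≤ volume {x | τ < v x})
    {H : ℝ → ℝ} (hHm : Measurable H) (hH0 : ∀ r, 0 ≤ H r)
    (hHd : ∀ r, deriv φ r = 0 → H r = 0)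
    (hHg : ∀ x : EuclideanSpace ℝ (Fin n), x ≠ 0 → H ‖x‖ * g x = |deriv φ ‖x‖|)
    {N : ℝ} (hN : 0 ≤ N) :
    ∫⁻ x : EuclideanSpace ℝ (Fin n), ENNReal.ofReal (min (H ‖x‖) N ^ p * g x) ≤
      ∫⁻ x, ENNReal.ofReal (‖fderiv ℝ v x‖ ^ p * g x ^ (1 - p)) := by
  have : Nonempty (Fin n) := ⟨⟨0, Nat.pos_of_ne_zero hn⟩⟩
  have hp0 : 0 < p := by linarith
  have hae : ∀ᵐ x : EuclideanSpace ℝ (Fin n), x ≠ 0 := by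
    simp [ae_iff]
  set MM : ℝ → ℝ := fun r => min (H r) N with hMM
  have hMMm : Measurable MM := hHm.min measurable_const
  have hMM0 : ∀ r, 0 ≤ MM r := fun r => le_min (hH0 r) hN
  have hMMd : ∀ r, deriv φ r = 0 → MM r = 0 := fun r h => by
    simp only [hMM, hHd r h, min_eq_left hN]
  set k : ℝ → ENNReal := fun τ => ENNReal.ofReal (MM (ρ τ) ^ (p - 1)) with hk
  set F : ℝ → ENNReal := fun τ => ENNReal.ofReal (MM (ρ τ) ^ p) with hF
  have hMρ : Measurable fun τ => MM (ρ τ) := hMMm.comp hρa.measurable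
  have hkm : Measurable k := (hMρ.pow_const _).ennreal_ofReal
  have hFm : Measurable F := (hMρ.pow_const _).ennreal_ofReal
  have hvm := hv.continuous.measurable
  have hgm' : Measurable fun x => ENNReal.ofReal (g x) := hgm.ennreal_ofReal
  have hφm : Measurable fun x : EuclideanSpace ℝ (Fin n) => φ ‖x‖ :=
    hφ.measurable.comp measurable_norm
  have hFv : Measurable fun x => F (v x) := hFm.comp hvm
  have hFφ : Measurable fun x : EuclideanSpace ℝ (Fin n) => F (φ ‖x‖) := hFm.comp hφm
  set X := ∫⁻ x : EuclideanSpace ℝ (Fin n), ENNReal.ofReal (MM ‖x‖ ^ p * g x) with hX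
  set Y := ∫⁻ x, ENNReal.ofReal (‖fderiv ℝ v x‖ ^ p * g x ^ (1 - p)) with hY
  have hsplit : ∀ (a b : ℝ), 0 ≤ a → ENNReal.ofReal (a * b) = ENNReal.ofReal a * ENNReal.ofReal b :=
    fun a b ha => ENNReal.ofReal_mul ha
  have hpos0 : ∀ x : EuclideanSpace ℝ (Fin n), x ≠ 0 → ¬ 0 < φ ‖x‖ → MM ‖x‖ = 0 := by
    intro x hx h
    by_contra hne
    apply h
    exact (radA1 hφ hφ0 hiff (norm_pos_iff.2 hx) (fun hd => hne (hMMd _ hd))).1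
  -- step 1
  have s1 : X ≤ ∫⁻ x : EuclideanSpace ℝ (Fin n), k (φ ‖x‖) * ENNReal.ofReal |deriv φ ‖x‖| := by
    apply lintegral_mono_ae
    filter_upwards [hae] with x hx
    by_cases hd : deriv φ ‖x‖ = 0
    · simp [hMMd _ hd, Real.zero_rpow hp0.ne']
    · have h1 := (radA1 hφ hφ0 hiff (norm_pos_iff.2 hx) hd).2
      simp only [hk, h1]
      rw [← hsplit _ _ (Real.rpow_nonneg (hMM0 _) _)]
      apply ENNReal.ofReal_le_ofReal
      rw [← hHg x hx]
      have h2 : MM ‖x‖ ^ p ≤ MM ‖x‖ ^ (p - 1) * H ‖x‖ := by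
        rcases (hMM0 ‖x‖).eq_or_lt with h0 | h0
        · rw [← h0, Real.zero_rpow hp0.ne']
          exact mul_nonneg (Real.rpow_nonneg le_rfl _) (hH0 _)
        · calc MM ‖x‖ ^ p = MM ‖x‖ ^ (p - 1) * MM ‖x‖ := by
                rw [Real.rpow_sub_one h0.ne', div_mul_cancel₀ _ h0.ne']
            _ ≤ _ := mul_le_mul_of_nonneg_left (min_le_left _ _) (Real.rpow_nonneg h0.le _)
      calc MM ‖x‖ ^ p * g x ≤ MM ‖x‖ ^ (p - 1) * H ‖x‖ * g x :=
            mul_le_mul_of_nonneg_right h2 (hgpos x hx).le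
        _ = _ := by ring
  have s2 := (claimA hφ hφ0 hiff hn hkm).trans
    (claimB hn hv hv0 hc hρa.measurable hρvol hkm)
  -- step 3
  have s3 : ENNReal.ofReal p * ∫⁻ x in v ⁻¹' Ioi 0, k (v x) * ENNReal.ofReal ‖fderiv ℝ v x‖ ≤
      Y + ENNReal.ofReal (p - 1) * ∫⁻ x in v ⁻¹' Ioi 0, F (v x) ∂ν := by
    rw [← lintegral_const_mul' _ _ ENNReal.ofReal_ne_top, hν,
      setLIntegral_withDensity_eq_setLIntegral_mul _ hgm' hFv (hvm measurableSet_Ioi),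
      ← lintegral_const_mul' _ _ ENNReal.ofReal_ne_top]
    refine le_trans ?_ (add_le_add_left (setLIntegral_le_lintegral (v ⁻¹' Ioi 0) _) _)
    rw [← lintegral_add_right]
    · apply lintegral_mono_ae
      filter_upwards [ae_restrict_of_ae hae] with x hx
      simp only [hk, hF, Pi.mul_apply]
      rw [← hsplit _ _ (Real.rpow_nonneg (hMM0 _) _), ← hsplit _ _ hp0.le, mul_comm (ENNReal.ofReal (g x)),
        ← hsplit _ _ (Real.rpow_nonneg (hMM0 _) _), ← hsplit _ _ (by linarith : (0 : ℝ) ≤ p - 1),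
        ← ENNReal.ofReal_add]
      · exact ENNReal.ofReal_le_ofReal (young_weight hp (hMM0 _) (norm_nonneg _) (hgpos x hx))
      · exact mul_nonneg (Real.rpow_nonneg (norm_nonneg _) _) (Real.rpow_nonneg (hgpos x hx).le _)
      · exact mul_nonneg (by linarith) (mul_nonneg (Real.rpow_nonneg (hMM0 _) _) (hgpos x hx).le)
    · exact (hgm'.mul hFv).const_mul _
  -- step 4
  have s4 : ∫⁻ x in v ⁻¹' Ioi 0, F (v x) ∂ν ≤ X := by
    have hC := claimC hfin hvm hφ hρν hiff
    have e1 : ∫⁻ x in v ⁻¹' Ioi 0, F (v x) ∂ν = ∫⁻ τ in Ioi 0, F τ ∂(ν.map v) :=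
      (setLIntegral_map measurableSet_Ioi hFm hvm).symm
    rw [e1, hC, setLIntegral_map measurableSet_Ioi hFm hφm]
    refine (setLIntegral_le_lintegral _ _).trans ?_
    rw [hν, lintegral_withDensity_eq_lintegral_mul _ hgm' hFφ]
    apply lintegral_mono
    intro x
    simp only [hF, Pi.mul_apply]
    rw [mul_comm, hsplit _ _ (Real.rpow_nonneg (hMM0 _) _)]
    gcongr
    · exact hMM0 _
    · by_cases hd : deriv φ (ρ (φ ‖x‖)) = 0
      · rw [hMMd _ hd]; exact hMM0 _
      · rw [radA2 hφ hφ0 hiff (norm_nonneg x) (hρ0 _) hd]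
  -- step 5
  have s5 : X ≠ ⊤ := by
    have hb : ν (Metric.ball 0 (ρ 0)) ≠ ⊤ :=
      ne_top_of_le_ne_top (hfin _) (measure_mono Metric.ball_subset_closedBall)
    have : X ≤ ENNReal.ofReal (N ^ p) * ν (Metric.ball 0 (ρ 0)) := by
      rw [hν, withDensity_apply _ Metric.isOpen_ball.measurableSet,
        ← lintegral_const_mul _ hgm', ← lintegral_indicator Metric.isOpen_ball.measurableSet]
      apply lintegral_mono_ae
      filter_upwards [hae] with x hx
      by_cases hxb : x ∈ Metric.ball 0 (ρ 0)
      · rw [indicator_of_mem hxb, hsplit _ _ (Real.rpow_nonneg (hMM0 _) _)]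
        gcongr
        · exact hMM0 _
        · exact min_le_right _ _
      · rw [indicator_of_notMem hxb, hpos0 x hx, Real.zero_rpow hp0.ne']
        · simp
        · rw [hiff 0 _ le_rfl (norm_nonneg x)]
          simpa using hxb
    exact ne_top_of_le_ne_top (ENNReal.mul_ne_top ENNReal.ofReal_ne_top hb) this
  have s6 : ENNReal.ofReal p * X ≤ Y + ENNReal.ofReal (p - 1) * X :=
    calc ENNReal.ofReal p * X ≤ ENNReal.ofReal p *
          ∫⁻ x in v ⁻¹' Ioi 0, k (v x) * ENNReal.ofReal ‖fderiv ℝ v x‖ := by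
            gcongr
            exact s1.trans s2
      _ ≤ _ := s3
      _ ≤ _ := by gcongr
  have hpe : ENNReal.ofReal p = 1 + ENNReal.ofReal (p - 1) := by
    rw [← ENNReal.ofReal_one, ← ENNReal.ofReal_add zero_le_one (by linarith)]
    congr 1; ring
  rw [hpe, add_mul, one_mul] at s6
  exact (ENNReal.add_le_add_iff_right (ENNReal.mul_ne_top ENNReal.ofReal_ne_top s5)).1 s6

lemma assemble {n : ℕ} (hn : n ≠ 0) {p : ℝ} (hp : 1 ≤ p)
    {g : EuclideanSpace ℝ (Fin n) → ℝ}
    (hgm : Measurable g) (hgpos : ∀ x, x ≠ 0 → 0 < g x)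
    (hrad : ∀ x y : EuclideanSpace ℝ (Fin n), ‖x‖ = ‖y‖ → g x = g y)
    {ν : Measure (EuclideanSpace ℝ (Fin n))}
    (hν : ν = volume.withDensity fun x => ENNReal.ofReal (g x))
    (hfin : ∀ R, ν (Metric.closedBall 0 R) ≠ ⊤)
    {v : EuclideanSpace ℝ (Fin n) → ℝ} {K : NNReal} (hv : LipschitzWith K v)
    (hv0 : ∀ x, 0 ≤ v x) (hc : HasCompactSupport v) {φ ρ : ℝ → ℝ}
    (hφ : Antitone φ) (hφ0 : ∀ r, 0 ≤ φ r)
    (hiff : ∀ τ r, 0 ≤ τ → 0 ≤ r → (τ < φ r ↔ r < ρ τ))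
    (hρa : Antitone ρ) (hρ0 : ∀ τ, 0 ≤ ρ τ)
    (hρν : ∀ τ, 0 ≤ τ → ν (Metric.ball 0 (ρ τ)) = ν {x | τ < v x})
    (hρvol : ∀ τ, 0 ≤ τ → 0 < ρ τ →
      volume (Metric.ball (0 : EuclideanSpace ℝ (Fin n)) (ρ τ)) ≤ volume {x | τ < v x}) :
    ∫⁻ x : EuclideanSpace ℝ (Fin n), ENNReal.ofReal (|deriv φ ‖x‖| ^ p * g x ^ (1 - p)) ≤
      ∫⁻ x, ENNReal.ofReal (‖fderiv ℝ v x‖ ^ p * g x ^ (1 - p)) := by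
  have : Nonempty (Fin n) := ⟨⟨0, Nat.pos_of_ne_zero hn⟩⟩
  have hp0 : 0 < p := by linarith
  have hae : ∀ᵐ x : EuclideanSpace ℝ (Fin n), x ≠ 0 := by
    simp [ae_iff]
  obtain ⟨e, he⟩ := _root_.exists_norm_eq (EuclideanSpace ℝ (Fin n)) zero_le_one
  set H : ℝ → ℝ := fun r => |deriv φ r| / |g (r • e)| with hH
  have hHm : Measurable H := by
    have h1 : Measurable fun r : ℝ => g (r • e) := hgm.comp (by fun_prop)
    have h2 := measurable_deriv φ
    exact (measurable_abs.comp h2).div (measurable_abs.comp h1)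
  have hH0 : ∀ r, 0 ≤ H r := fun r => by positivity
  have hHd : ∀ r, deriv φ r = 0 → H r = 0 := fun r h => by simp [hH, h]
  have hHe : ∀ x : EuclideanSpace ℝ (Fin n), x ≠ 0 → H ‖x‖ = |deriv φ ‖x‖| / g x := by
    intro x hx
    have : g (‖x‖ • e) = g x := hrad _ _ (by rw [norm_smul, he, norm_norm, mul_one])
    simp only [hH, this, abs_of_pos (hgpos x hx)]
  have hHg : ∀ x : EuclideanSpace ℝ (Fin n), x ≠ 0 → H ‖x‖ * g x = |deriv φ ‖x‖| := by
    intro x hx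
    rw [hHe x hx, div_mul_cancel₀ _ (hgpos x hx).ne']
  have hT := fun N : ℕ => assemble_trunc hn hp hgm hgpos hν hfin hv hv0 hc hφ hφ0 hiff hρa hρ0 hρν
    hρvol hHm hH0 hHd hHg (Nat.cast_nonneg N)
  have hlim : Tendsto (fun N : ℕ => ∫⁻ x : EuclideanSpace ℝ (Fin n),
      ENNReal.ofReal (min (H ‖x‖) N ^ p * g x)) atTop
      (𝓝 (∫⁻ x : EuclideanSpace ℝ (Fin n),
        ENNReal.ofReal (|deriv φ ‖x‖| ^ p * g x ^ (1 - p)))) := by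
    apply lintegral_tendsto_of_tendsto_of_monotone
    · intro N
      have h1 : Measurable fun x : EuclideanSpace ℝ (Fin n) => min (H ‖x‖) (N : ℝ) :=
        (hHm.comp measurable_norm).min measurable_const
      exact ((h1.pow_const p).mul hgm).ennreal_ofReal.aemeasurable
    · filter_upwards [hae] with x hx
      intro N N' hNN
      apply ENNReal.ofReal_le_ofReal
      refine mul_le_mul_of_nonneg_right ?_ (hgpos x hx).le
      refine Real.rpow_le_rpow (le_min (hH0 _) (Nat.cast_nonneg N)) ?_ hp0.le
      exact min_le_min_left _ (Nat.cast_le.2 hNN)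
    · filter_upwards [hae] with x hx
      refine tendsto_const_nhds.congr' ?_
      obtain ⟨N0, hN0⟩ := exists_nat_ge (H ‖x‖)
      filter_upwards [eventually_ge_atTop N0] with N hN
      have hg := hgpos x hx
      rw [min_eq_left (hN0.trans (Nat.cast_le.2 hN)), hHe x hx,
        Real.div_rpow (abs_nonneg _) hg.le, Real.rpow_sub hg, Real.rpow_one]
      congr 1
      field_simp
  exact le_of_tendsto' hlim hT

/-- Weighted Pólya–Szegő-type inequality: for `1 ≤ p < ∞` and admissible `g > 0` off the
origin, every compactly supported Lipschitz `u : ℝⁿ → ℝ` satisfies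
`∫ |∇u|^p g^{1-p} ≥ ∫ |∇(R_g[u])|^p g^{1-p}` (gradients taken a.e.). -/
theorem stmt12 (n : ℕ) (p : ℝ) (hp : 1 ≤ p) (g : EuclideanSpace ℝ (Fin n) → ℝ)
    (hg : Admissible n g) (hgpos : ∀ x : EuclideanSpace ℝ (Fin n), x ≠ 0 → 0 < g x)
    (u : EuclideanSpace ℝ (Fin n) → ℝ) (K : NNReal) (hu : LipschitzWith K u)
    (hsupp : HasCompactSupport u) :
    ∫⁻ x, ENNReal.ofReal (‖fderiv ℝ (rearrG n g u) x‖ ^ p * g x ^ (1 - p)) ≤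
      ∫⁻ x, ENNReal.ofReal (‖fderiv ℝ u x‖ ^ p * g x ^ (1 - p)) := by
  have hp0 : 0 < p := by linarith
  rcases eq_or_ne n 0 with rfl | hn
  · have h0 : ∀ x, ‖fderiv ℝ (rearrG 0 g u) x‖ = 0 := by
      intro x
      rw [Subsingleton.elim (fderiv ℝ (rearrG 0 g u) x) 0, norm_zero]
    simp only [h0, Real.zero_rpow hp0.ne', zero_mul, ENNReal.ofReal_zero, lintegral_zero]
    exact zero_le
  obtain ⟨hloc, hrad, hcont, -, hmono⟩ := hg
  have : Nonempty (Fin n) := ⟨⟨0, Nat.pos_of_ne_zero hn⟩⟩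
  have hae : ∀ᵐ x : EuclideanSpace ℝ (Fin n), x ≠ 0 := by
    simp [ae_iff]
  have hgm : Measurable g := measurable_of_continuousOn_compl_singleton 0 hcont
  obtain ⟨ν, hν⟩ : ∃ ν : Measure (EuclideanSpace ℝ (Fin n)),
    ν = volume.withDensity fun x => ENNReal.ofReal (g x) := ⟨_, rfl⟩
  have hgm' : Measurable fun x => ENNReal.ofReal (g x) := hgm.ennreal_ofReal
  have hac : ν ≪ volume := hν ▸ withDensity_absolutelyContinuous _ _
  have hca : volume ≪ ν := by
    rw [hν]
    apply withDensity_absolutelyContinuous' hgm'.aemeasurable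
    filter_upwards [hae] with x hx
    simpa using hgpos x hx
  have hfin : ∀ R, ν (Metric.closedBall 0 R) ≠ ⊤ := by
    intro R
    rw [hν, withDensity_apply _ Metric.isClosed_closedBall.measurableSet]
    have h1 : IntegrableOn g (Metric.closedBall 0 R) :=
      hloc.integrableOn_isCompact (isCompact_closedBall 0 R)
    exact (h1.lintegral_lt_top).ne
  obtain ⟨v, hv⟩ : ∃ v : EuclideanSpace ℝ (Fin n) → ℝ, v = fun x => |u x| := ⟨_, rfl⟩
  have hvL : LipschitzWith K v := by
    rw [hv]
    have := (lipschitzWith_one_norm (E := ℝ)).comp hu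
    rw [one_mul] at this
    exact this
  have hv0 : ∀ x, 0 ≤ v x := fun x => by rw [hv]; exact abs_nonneg _
  have hvc : HasCompactSupport v := by
    rw [hv]
    exact hsupp.norm
  obtain ⟨C, hC⟩ := hvc.exists_bound_of_continuous hvL.continuous
  have hC' : ∀ x, v x ≤ C := fun x => (le_abs_self _).trans (hC x)
  obtain ⟨R, hR0, hR⟩ : ∃ R : ℝ, 0 ≤ R ∧ ∀ x, 0 < v x → x ∈ Metric.ball 0 R := by
    obtain ⟨R, hR⟩ := (show IsCompact (tsupport v) from hvc).isBounded.subset_ball 0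
    refine ⟨max R 0, le_max_right _ _, fun x hx => ?_⟩
    exact Metric.ball_subset_ball (le_max_left _ _) (hR (subset_tsupport v hx.ne'))
  obtain ⟨φ, hφd⟩ : ∃ φ : ℝ → ℝ, ∀ r,
    φ r = sSup {t : ℝ | 0 ≤ t ∧ ν (Metric.ball 0 r) < ν {x | t < v x}} := ⟨_, fun _ => rfl⟩
  have hvm := hvL.continuous.measurable
  have hRe : rearrG n g u = fun x => φ ‖x‖ := by
    funext x
    rw [hφd, rearrG]
    congr 1
    ext t
    have e1 : ν (Metric.ball 0 ‖x‖) = muG n g (Metric.ball 0 ‖x‖) := by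
      rw [hν, withDensity_apply _ Metric.isOpen_ball.measurableSet, muG]
    have e2 : ν {x | t < v x} = distG n g u t := by
      rw [hν, withDensity_apply _ (measurableSet_lt measurable_const hvm), distG, muG, hv]
    simp only [mem_ofPred_eq, e1, e2]
  obtain ⟨ρ, hρa, hρ0, hρν, hφ, hφ0, hiff⟩ :=
    setup_rho hn hac hca hfin hR0 hR hC' hφd
  have hρvol : ∀ τ, 0 ≤ τ → 0 < ρ τ →
      volume (Metric.ball (0 : EuclideanSpace ℝ (Fin n)) (ρ τ)) ≤ volume {x | τ < v x} := by
    intro τ hτ hpos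
    refine vol_ball_le hn hgm hgpos hmono hpos (measurableSet_lt measurable_const hvm) ?_ ?_
    · rw [← hν]
      exact ne_top_of_le_ne_top (hfin _) (measure_mono Metric.ball_subset_closedBall)
    · rw [← hν]
      exact hρν τ hτ
  have hmain := assemble hn hp hgm hgpos hrad hν hfin hvL hv0 hvc hφ hφ0 hiff hρa hρ0 hρν hρvol
  calc ∫⁻ x, ENNReal.ofReal (‖fderiv ℝ (rearrG n g u) x‖ ^ p * g x ^ (1 - p))
      ≤ ∫⁻ x : EuclideanSpace ℝ (Fin n),
          ENNReal.ofReal (|deriv φ ‖x‖| ^ p * g x ^ (1 - p)) := by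
        apply lintegral_mono_ae
        filter_upwards [hae] with x hx
        apply ENNReal.ofReal_le_ofReal
        refine mul_le_mul_of_nonneg_right ?_ (Real.rpow_nonneg (hgpos x hx).le _)
        rw [hRe]
        exact Real.rpow_le_rpow (norm_nonneg _) (norm_fderiv_radial_le φ hx) hp0.le
    _ ≤ ∫⁻ x, ENNReal.ofReal (‖fderiv ℝ v x‖ ^ p * g x ^ (1 - p)) := hmain
    _ ≤ _ := by
        apply lintegral_mono_ae
        filter_upwards [hae] with x hx
        apply ENNReal.ofReal_le_ofReal
        refine mul_le_mul_of_nonneg_right ?_ (Real.rpow_nonneg (hgpos x hx).le _)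
        rw [hv]
        exact Real.rpow_le_rpow (norm_nonneg _) (norm_fderiv_abs_le hu.continuous x) hp0.le
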